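/- Let p be a prime, let delta > 0 be a constant and let n >= 1 be an integer. Then there is a constant Qbar such that for every q = p^h with q >= Qbar and every code word c of C_n(H(2n+1,q^2))^perp with wt(c) <= delta * q^{2n-1}, the code word c is an F_p-linear combination of code words of the form v_pi - v_{pi^sigma}, where pi ranges over the n-dimensional projective subspaces of PG(2n+1,q^2). -/

import Mathlib

open scoped BigOperators

namespace HermCode

/-- The Hermitian sesquilinear form `h(x,y) = ∑ᵢ xᵢ * yᵢ^q` on `F^m`. -/
def herm (q : ℕ) {F : Type} [Field F] {m : ℕ} (x y : Fin m → F) : F :=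
  ∑ i, x i * (y i) ^ q

/-- For a fixed vector `x`, the linear map `y ↦ h(y,x)`. -/
def hermL (q : ℕ) {F : Type} [Field F] {m : ℕ} (x : Fin m → F) :
    (Fin m → F) →ₗ[F] F where
  toFun y := herm q y x
  map_add' a b := by
    simp [herm, add_mul, Finset.sum_add_distrib]
  map_smul' c a := by
    simp [herm, Finset.mul_sum, mul_assoc]

/-- The image `W^σ` of a subspace `W` under the Hermitian polarity `σ`:
the subspace of all vectors orthogonal to every vector of `W`
with respect to the Hermitian form. -/
def polar (q : ℕ) {F : Type} [Field F] {m : ℕ} (W : Submodule F (Fin m → F)) :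
    Submodule F (Fin m → F) :=
  ⨅ x : W, LinearMap.ker (hermL q (x : Fin m → F))

/-- A subspace all of whose points lie on the Hermitian variety. -/
def TotallyIsotropic (q : ℕ) {F : Type} [Field F] {m : ℕ}
    (W : Submodule F (Fin m → F)) : Prop :=
  ∀ x ∈ W, herm q x x = 0

/-- A point of the Hermitian variety: a projective point (1-dimensional subspace)
spanned by an isotropic vector. -/
def IsHermPoint (q : ℕ) {F : Type} [Field F] {m : ℕ}
    (P : Submodule F (Fin m → F)) : Prop :=
  Module.finrank F P = 1 ∧ TotallyIsotropic q P

/-- A generator of `H(2n+1,q²)`: an `n`-dimensional projective subspace all of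
whose points lie on the Hermitian variety. -/
def IsGenerator (q n : ℕ) {F : Type} [Field F]
    (W : Submodule F (Fin (2*n+2) → F)) : Prop :=
  Module.finrank F W = n + 1 ∧ TotallyIsotropic q W

/-- A code word of the dual code `C_n(H(2n+1,q²))^⊥`: a function from points to `F_p`
(vanishing off the Hermitian variety) summing to zero over every generator. -/
def IsCodeword (p q n : ℕ) {F : Type} [Field F]
    (c : Submodule F (Fin (2*n+2) → F) → ZMod p) : Prop :=
  (∀ P, ¬ IsHermPoint q P → c P = 0) ∧
  ∀ μ, IsGenerator q n μ → (∑ᶠ P ∈ {P | IsHermPoint q P ∧ P ≤ μ}, c P) = 0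

/-- The (Hamming) weight of a code word. -/
noncomputable def wt {p : ℕ} {α : Type*} (c : α → ZMod p) : ℕ :=
  Nat.card {x : α // c x ≠ 0}

open scoped Classical in
/-- The incidence vector `v_π` of `π ∩ H`. -/
noncomputable def vsub (p q : ℕ) {F : Type} [Field F] {m : ℕ}
    (π : Submodule F (Fin m → F)) : Submodule F (Fin m → F) → ZMod p :=
  fun P => if IsHermPoint q P ∧ P ≤ π then 1 else 0

/-- `θ_m(q)`, the number of points of `PG(m,q)`. -/
noncomputable def theta (q : ℕ) (m : ℤ) : ℚ :=
  ((q:ℚ)^(m+1) - 1) / ((q:ℚ) - 1)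

/-- `μ_m(q²)`, the number of points of `H(m,q²)` (with `μ_{-1} = 0`). -/
noncomputable def muH (q : ℕ) (m : ℤ) : ℚ :=
  (((q:ℚ)^(m+1) - (-1:ℚ)^(m+1)) * ((q:ℚ)^m - (-1:ℚ)^m)) / ((q:ℚ)^2 - 1)

/-- The number `N(n,i)`. -/
noncomputable def NN (q n : ℕ) (i : ℤ) : ℚ :=
  (q:ℚ)^(((n:ℤ)-1)^2 - ((((n:ℤ)-i-1).toNat.choose 2 : ℕ) : ℤ)) *
    ∏ j ∈ Finset.range ((n:ℤ)-i-2).toNat, ((q:ℚ)^(j+1) - (-1:ℚ)^(j+1))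

open scoped Classical in
/-- The quantity `Σ_{n,i}`. -/
noncomputable def SigmaNI (q n : ℕ) (i : ℤ) : ℚ :=
  if Odd ((n:ℤ) - i) then
    2*(q:ℚ)^(2*i+2) * muH q ((n:ℤ)-i-1)
      + 4 * muH q ((n:ℤ)-i-2) * ((q:ℚ)^((n:ℤ)-i-1) - 1)
          / ((q:ℚ)^((n:ℤ)-3*i-5) * ((q:ℚ)^2 - 1))
  else
    2*(q:ℚ)^(2*i+2) * (muH q ((n:ℤ)-i-1)
      + 2*((q:ℚ)^(4:ℤ) * muH q ((n:ℤ)-i-3) + (q:ℚ)^2 - 1)/((q:ℚ)^2 - 1))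

/-- `P` lies on a projective line entirely contained in the Hermitian variety that
meets both `π \ (π ⊓ π^σ)` and `π^σ \ (π ⊓ π^σ)`. -/
def OnGoodLine (q : ℕ) {F : Type} [Field F] {m : ℕ}
    (π P : Submodule F (Fin m → F)) : Prop :=
  ∃ A B : Submodule F (Fin m → F),
    Module.finrank F A = 1 ∧ A ≤ π ∧ ¬ A ≤ π ⊓ polar q π ∧
    Module.finrank F B = 1 ∧ B ≤ polar q π ∧ ¬ B ≤ π ⊓ polar q π ∧
    P ≤ A ⊔ B ∧ TotallyIsotropic q (A ⊔ B)

section helpers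



open Finset

structure HH (q : ℕ) (F : Type) [Field F] [Fintype F] : Prop where
  two : 2 ≤ q
  card : Fintype.card F = q ^ 2
  add : ∀ x y : F, (x + y) ^ q = x ^ q + y ^ q

set_option linter.unusedSectionVars false

section basics

variable {q : ℕ} {F : Type} [Field F] [Fintype F] {m : ℕ}

theorem HH.inv (H : HH q F) (x : F) : (x ^ q) ^ q = x := by
  rw [← pow_mul, ← sq, ← H.card, FiniteField.pow_card]

theorem HH.q0 (H : HH q F) : q ≠ 0 := by have := H.two; omega

theorem HH.zero (H : HH q F) : (0 : F) ^ q = 0 := zero_pow H.q0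

theorem HH.neg (H : HH q F) (x : F) : (-x) ^ q = - x ^ q := by
  have := H.add x (-x)
  rw [add_neg_cancel, H.zero] at this
  exact (neg_eq_of_add_eq_zero_right this.symm).symm

theorem HH.sum (H : HH q F) {ι : Type*} (s : Finset ι) (g : ι → F) :
    (∑ i ∈ s, g i) ^ q = ∑ i ∈ s, g i ^ q := by
  classical
  induction s using Finset.induction_on with
  | empty => simp [H.zero]
  | insert a s ha ih => rw [sum_insert ha, sum_insert ha, H.add, ih]

theorem herm_add_left (x y z : Fin m → F) : herm q (x + y) z = herm q x z + herm q y z := by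
  simp [herm, add_mul, sum_add_distrib]

theorem herm_smul_left (a : F) (x z : Fin m → F) : herm q (a • x) z = a * herm q x z := by
  simp [herm, mul_sum, mul_assoc]

theorem herm_add_right (H : HH q F) (x y z : Fin m → F) :
    herm q x (y + z) = herm q x y + herm q x z := by
  simp [herm, H.add, mul_add, sum_add_distrib]

theorem herm_smul_right (a : F) (x z : Fin m → F) :
    herm q x (a • z) = a ^ q * herm q x z := by
  simp [herm, mul_sum, mul_pow]
  refine sum_congr rfl fun i _ => by ring

theorem herm_swap (H : HH q F) (x y : Fin m → F) : herm q y x = (herm q x y) ^ q := by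
  simp only [herm, H.sum, mul_pow, H.inv]
  exact sum_congr rfl fun i _ => mul_comm _ _

theorem herm_zero_left (z : Fin m → F) : herm q 0 z = 0 := by simp [herm]

theorem herm_zero_right (H : HH q F) (z : Fin m → F) : herm q z 0 = 0 := by
  simp [herm, H.q0]

theorem herm_symm_zero (H : HH q F) {x y : Fin m → F} (h : herm q x y = 0) : herm q y x = 0 := by
  rw [herm_swap H, h, H.zero]

theorem herm_nondeg (H : HH q F) {x : Fin m → F} (h : ∀ y, herm q y x = 0) : x = 0 := by
  classical
  funext i
  have := h (Pi.single i 1)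
  simp only [herm, Pi.single_apply, ite_mul, one_mul, zero_mul, sum_ite_eq', mem_univ,
    if_true] at this
  exact pow_eq_zero_iff H.q0 |>.1 this

theorem mem_polar {W : Submodule F (Fin m → F)} {y : Fin m → F} :
    y ∈ polar q W ↔ ∀ x ∈ W, herm q y x = 0 := by
  simp only [polar, Submodule.mem_iInf, Subtype.forall, LinearMap.mem_ker]
  rfl

theorem mem_polar' (H : HH q F) {W : Submodule F (Fin m → F)} {y : Fin m → F} :
    y ∈ polar q W ↔ ∀ x ∈ W, herm q x y = 0 := by
  rw [mem_polar]
  exact ⟨fun h x hx => herm_symm_zero H (h x hx), fun h x hx => herm_symm_zero H (h x hx)⟩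

theorem finrank_polar (H : HH q F) (W : Submodule F (Fin m → F)) :
    Module.finrank F (polar q W) + Module.finrank F W = m := by
  classical
  let b := Module.finBasis F W
  let Φ : (Fin m → F) →ₗ[F] (Fin (Module.finrank F W) → F) :=
    LinearMap.pi fun i => hermL q (b i : Fin m → F)
  have hΦ : ∀ y i, Φ y i = herm q y (b i : Fin m → F) := fun y i => rfl
  have hsum : ∀ (y : Fin m → F) (d : Fin (Module.finrank F W) → F),
      herm q y (∑ i, d i • (b i : Fin m → F)) = ∑ i, (d i) ^ q * herm q y (b i) := by
    intro y d
    have : ∀ s : Finset (Fin (Module.finrank F W)),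
      herm q y (∑ i ∈ s, d i • (b i : Fin m → F)) = ∑ i ∈ s, (d i) ^ q * herm q y (b i) := by
      intro s
      induction s using Finset.induction_on with
      | empty => simp [herm_zero_right H]
      | insert a s ha ih => rw [sum_insert ha, sum_insert ha, herm_add_right H, ih, herm_smul_right]
    exact this univ
  have hker : LinearMap.ker Φ = polar q W := by
    ext y
    rw [LinearMap.mem_ker, mem_polar]
    constructor
    · intro h x hx
      have hx' : x = ∑ i, (b.repr ⟨x, hx⟩ i) • (b i : Fin m → F) := by
        have := congrArg (Subtype.val) (b.sum_repr ⟨x, hx⟩)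
        simp only [Submodule.coe_sum, Submodule.coe_smul] at this
        exact this.symm
      rw [hx', hsum]
      refine sum_eq_zero fun i _ => ?_
      rw [← hΦ, h]; simp
    · intro h
      funext i
      rw [hΦ]; exact h _ (b i).2
  have hrange : LinearMap.range Φ = ⊤ := by
    by_contra hne
    obtain ⟨φ, hφ, hle⟩ := Submodule.exists_le_ker_of_lt_top _ (lt_top_iff_ne_top.2 hne)
    apply hφ
    have hφs : ∀ v, φ v = ∑ i, v i * φ (Pi.single i 1) := by
      intro v
      conv_lhs => rw [pi_eq_sum_univ' v]
      rw [map_sum]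
      refine sum_congr rfl fun i _ => ?_
      rw [map_smul, smul_eq_mul]
    have h0 : (∑ i, (φ (Pi.single i 1)) ^ q • (b i : Fin m → F)) = 0 := by
      apply herm_nondeg H
      intro y
      rw [hsum]
      have : φ (Φ y) = 0 := hle ⟨y, rfl⟩
      rw [hφs] at this
      rw [← this]
      refine sum_congr rfl fun i _ => ?_
      rw [H.inv, hΦ, mul_comm]
    have h1 : (∑ i, (φ (Pi.single i 1)) ^ q • b i) = 0 := by
      apply Subtype.ext
      simpa using h0
    have h2 := Fintype.linearIndependent_iff.1 b.linearIndependent _ h1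
    ext v
    simp only [LinearMap.comp_apply, LinearMap.zero_apply]
    rw [hφs]
    refine sum_eq_zero fun i _ => ?_
    rw [pow_eq_zero_iff H.q0 |>.1 (h2 i), mul_zero]
  have := LinearMap.finrank_range_add_finrank_ker Φ
  rw [hrange, hker] at this
  simp at this
  omega

theorem le_polar_polar (H : HH q F) (W : Submodule F (Fin m → F)) : W ≤ polar q (polar q W) := by
  intro x hx
  rw [mem_polar' H]
  intro y hy
  exact mem_polar.1 hy x hx

theorem polar_polar (H : HH q F) (W : Submodule F (Fin m → F)) : polar q (polar q W) = W := by
  refine (Submodule.eq_of_le_of_finrank_le (le_polar_polar H W) ?_).symm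
  have h1 := finrank_polar H W
  have h2 := finrank_polar H (polar q W)
  omega

theorem polar_anti {W W' : Submodule F (Fin m → F)} (h : W ≤ W') : polar q W' ≤ polar q W := by
  intro x hx
  rw [mem_polar] at *
  exact fun y hy => hx y (h hy)

theorem polar_sup (H : HH q F) (W W' : Submodule F (Fin m → F)) :
    polar q (W ⊔ W') = polar q W ⊓ polar q W' := by
  apply le_antisymm
  · exact le_inf (polar_anti le_sup_left) (polar_anti le_sup_right)
  · rintro x ⟨h1, h2⟩
    have h1 := mem_polar.1 h1
    have h2 := mem_polar.1 h2
    rw [mem_polar]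
    intro y hy
    obtain ⟨a, ha, b, hb, rfl⟩ := Submodule.mem_sup.1 hy
    rw [herm_add_right H, h1 a ha, h2 b hb, add_zero]

theorem mem_polar_span {x y : Fin m → F} :
    y ∈ polar q (Submodule.span F {x}) ↔ herm q y x = 0 := by
  rw [mem_polar]
  constructor
  · intro h; exact h x (Submodule.mem_span_singleton_self x)
  · intro h z hz
    obtain ⟨a, rfl⟩ := Submodule.mem_span_singleton.1 hz
    rw [herm_smul_right, h, mul_zero]

/-- trace fibres have at most `q` elements -/
theorem trace_fiber_le [DecidableEq F] (H : HH q F) (s e : F) :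
    #{t : F | t ^ q + s * t = e} ≤ q := by
  let P : Polynomial F := Polynomial.X ^ q + (Polynomial.C s * Polynomial.X - Polynomial.C e)
  have hd : (Polynomial.C s * Polynomial.X - Polynomial.C e : Polynomial F).degree < (q : ℕ) := by
    refine lt_of_le_of_lt (Polynomial.degree_sub_le _ _) ?_
    have h2 := H.two
    refine max_lt ?_ ?_
    · refine lt_of_le_of_lt (Polynomial.degree_C_mul_X_le _) ?_
      exact_mod_cast h2
    · refine lt_of_le_of_lt (Polynomial.degree_C_le) ?_
      exact_mod_cast (by omega : 0 < q)
  have hm : P.Monic := Polynomial.monic_X_pow_add hd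
  have hdeg : P.natDegree = q := Polynomial.natDegree_eq_of_degree_eq_some
    (by rw [Polynomial.degree_add_eq_left_of_degree_lt] <;> rw [Polynomial.degree_X_pow]; exact hd)
  have hsub : ({t : F | t ^ q + s * t = e} : Finset F) ⊆ P.roots.toFinset := by
    intro t ht
    rw [mem_filter] at ht
    rw [Multiset.mem_toFinset, Polynomial.mem_roots hm.ne_zero]
    simp only [P, Polynomial.IsRoot.def, Polynomial.eval_add, Polynomial.eval_sub,
      Polynomial.eval_pow, Polynomial.eval_X, Polynomial.eval_mul, Polynomial.eval_C]
    rw [← ht.2]; ring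
  calc _ ≤ _ := card_le_card hsub
    _ ≤ _ := Multiset.toFinset_card_le _
    _ ≤ _ := Polynomial.card_roots' _
    _ = q := hdeg

theorem norm_fiber_le [DecidableEq F] (e : F) :
    #{t : F | t ^ (q+1) = e} ≤ q + 1 := by
  have hsub : ({t : F | t ^ (q+1) = e} : Finset F) ⊆ (Polynomial.nthRoots (q+1) e).toFinset := by
    intro t ht
    rw [mem_filter] at ht
    rw [Multiset.mem_toFinset, Polynomial.mem_nthRoots (by omega)]
    exact ht.2
  exact (card_le_card hsub).trans ((Multiset.toFinset_card_le _).trans (Polynomial.card_nthRoots _ _))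

/-- every trace fibre over the fixed field has at least `q` elements -/
theorem trace_fiber_ge [DecidableEq F] (H : HH q F) (e : F) (he : e ^ q = e) :
    q ≤ #{t : F | t ^ q + t = e} := by
  have hFq : #{x : F | x ^ q = x} ≤ q := by
    have := trace_fiber_le H (-1) 0
    refine le_trans (card_le_card ?_) this
    intro t ht
    simp only [mem_filter, mem_univ, true_and] at *
    rw [ht]; ring
  have hmaps : ∀ t ∈ (univ : Finset F), t ^ q + t ∈ ({x : F | x ^ q = x} : Finset F) := by
    intro t _
    simp only [mem_filter, mem_univ, true_and]
    rw [H.add, H.inv, add_comm]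
  have hc := card_eq_sum_card_fiberwise hmaps
  rw [card_univ, H.card] at hc
  have hmem : e ∈ ({x : F | x ^ q = x} : Finset F) := by simpa using he
  rw [← add_sum_erase _ _ hmem] at hc
  have hle : ∑ x ∈ ({x : F | x ^ q = x} : Finset F).erase e, #{a ∈ (univ : Finset F) | a ^ q + a = x}
      ≤ (q - 1) * q := by
    refine (sum_le_card_nsmul _ _ q ?_).trans ?_
    · intro x _
      have := trace_fiber_le H 1 x
      simpa using this
    · rw [card_erase_of_mem hmem, smul_eq_mul]
      exact Nat.mul_le_mul_right _ (by omega)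
  have h2 := H.two
  obtain ⟨k, rfl⟩ : ∃ k, q = k + 1 := ⟨q - 1, by omega⟩
  simp only [Nat.add_sub_cancel] at hle
  nlinarith

theorem norm_surj (H : HH q F) (e : F) (he : e ^ q = e) (h0 : e ≠ 0) : ∃ t : F, t ^ (q+1) = e := by
  classical
  obtain ⟨g, hg⟩ := IsCyclic.exists_generator (α := Fˣ)
  have hord : orderOf g = q ^ 2 - 1 := by
    rw [orderOf_eq_card_of_forall_mem_zpowers hg, Nat.card_eq_fintype_card, Fintype.card_units, H.card]
  obtain ⟨k, hk⟩ := (mem_powers_iff_mem_zpowers.2 (hg (Units.mk0 e h0)))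
  simp only at hk
  have h2 := H.two
  have h1 : (Units.mk0 e h0) ^ (q - 1) = 1 := by
    apply Units.ext
    simp only [Units.val_pow_eq_pow_val, Units.val_mk0, Units.val_one]
    have : e ^ (q - 1) * e = 1 * e := by
      rw [← pow_succ, Nat.sub_add_cancel (by omega), he, one_mul]
    exact mul_right_cancel₀ h0 this
  rw [← hk, ← pow_mul] at h1
  have hdvd := orderOf_dvd_of_pow_eq_one h1
  rw [hord] at hdvd
  have hfac : q ^ 2 - 1 = (q + 1) * (q - 1) := by
    have := Nat.sq_sub_sq q 1
    simpa using this
  rw [hfac] at hdvd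
  obtain ⟨j, rfl⟩ := Nat.dvd_of_mul_dvd_mul_right (by omega) hdvd
  refine ⟨((g ^ j : Fˣ) : F), ?_⟩
  have := congrArg (Units.val) hk
  simp only [Units.val_mk0] at this
  rw [← this, ← Units.val_pow_eq_pow_val, ← pow_mul, mul_comm j]

theorem ti_le_polar (H : HH q F) {W : Submodule F (Fin m → F)} (hW : TotallyIsotropic q W) :
    W ≤ polar q W := by
  classical
  intro x hx
  rw [mem_polar]
  intro y hy
  by_contra hne
  have key : ∀ a : F, a ^ q + a = 0 := by
    intro a
    have h := hW ((a / herm q x y) • x + y) (W.add_mem (W.smul_mem _ hx) hy)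
    rw [herm_add_left, herm_add_right H, herm_add_right H, herm_smul_left, herm_smul_left,
      herm_smul_right, hW x hx, hW y hy, herm_smul_right, herm_swap H x y, ← mul_pow,
      div_mul_cancel₀ _ hne] at h
    rw [← h]; ring
  have := trace_fiber_le H 1 0
  have hu : ({t : F | t ^ q + 1 * t = 0} : Finset F) = univ := by
    ext t; simp [key]
  rw [hu, card_univ, H.card] at this
  have h2 := H.two
  nlinarith

theorem ti_iff (H : HH q F) {W : Submodule F (Fin m → F)} :
    TotallyIsotropic q W ↔ W ≤ polar q W :=
  ⟨ti_le_polar H, fun h x hx => mem_polar.1 (h hx) x hx⟩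

/-- adjoin an orthogonal isotropic vector -/
theorem ti_sup (H : HH q F) {W : Submodule F (Fin m → F)} (hW : TotallyIsotropic q W)
    {x : Fin m → F} (hx : x ∈ polar q W) (hxx : herm q x x = 0) :
    TotallyIsotropic q (W ⊔ Submodule.span F {x}) := by
  have hle := ti_le_polar H hW
  intro z hz
  obtain ⟨a, ha, b, hb, rfl⟩ := Submodule.mem_sup.1 hz
  obtain ⟨t, rfl⟩ := Submodule.mem_span_singleton.1 hb
  have h1 := mem_polar.1 hx a ha
  have h2 := herm_symm_zero H h1
  rw [herm_add_left, herm_add_right H, herm_add_right H, herm_smul_left, herm_smul_left,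
      herm_smul_right, herm_smul_right, hW a ha, h1, h2, hxx]
  ring

theorem finrank_sup_span {W : Submodule F (Fin m → F)} {x : Fin m → F} (hx : x ∉ W) :
    Module.finrank F (W ⊔ Submodule.span F {x} : Submodule F (Fin m → F)) =
      Module.finrank F W + 1 := by
  have h0 : x ≠ 0 := fun h => hx (h ▸ W.zero_mem)
  have h := Submodule.finrank_sup_add_finrank_inf_eq W (Submodule.span F {x})
  have hinf : W ⊓ Submodule.span F {x} = ⊥ := by
    rw [eq_bot_iff]
    rintro z ⟨h1, h2⟩
    obtain ⟨t, rfl⟩ := Submodule.mem_span_singleton.1 h2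
    by_cases ht : t = 0
    · simp [ht]
    · exact absurd ((W.smul_mem_iff ht).1 h1) hx
  rw [hinf, finrank_bot, finrank_span_singleton h0] at h
  omega

theorem exists_isotropic_ext (H : HH q F) {W : Submodule F (Fin m → F)}
    (hW : TotallyIsotropic q W) (hd : 2 * Module.finrank F W + 2 ≤ m) :
    ∃ x, x ∈ polar q W ∧ x ∉ W ∧ herm q x x = 0 := by
  have hfp := finrank_polar H W
  have hle := ti_le_polar H hW
  obtain ⟨x, hx, hxW⟩ : ∃ x ∈ polar q W, x ∉ W := by
    by_contra hcon
    push Not at hcon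
    have := Submodule.finrank_mono (show polar q W ≤ W from hcon)
    omega
  by_cases hxx : herm q x x = 0
  · exact ⟨x, hx, hxW, hxx⟩
  obtain ⟨y, hy, hyW⟩ : ∃ y ∈ polar q W, y ∉ W ⊔ Submodule.span F {x} := by
    by_contra hcon
    push Not at hcon
    have := Submodule.finrank_mono (show polar q W ≤ W ⊔ Submodule.span F {x} from hcon)
    rw [finrank_sup_span hxW] at this
    omega
  -- orthogonalise
  set y' := y + (-(herm q y x / herm q x x)) • x with hy'
  have hy'x : herm q y' x = 0 := by
    rw [hy', herm_add_left, herm_smul_left]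
    field_simp
    ring
  have hy'p : y' ∈ polar q W := Submodule.add_mem _ hy (Submodule.smul_mem _ _ hx)
  have hy'W : y' ∉ W ⊔ Submodule.span F {x} := by
    intro h
    apply hyW
    have : y = y' + (herm q y x / herm q x x) • x := by rw [hy']; module
    rw [this]
    exact Submodule.add_mem _ h (Submodule.smul_mem _ _
      (Submodule.mem_sup_right (Submodule.mem_span_singleton_self x)))
  clear_value y'
  by_cases hyy : herm q y' y' = 0
  · exact ⟨y', hy'p, fun h => hy'W (Submodule.mem_sup_left h), hyy⟩
  have hself : ∀ z : Fin m → F, (herm q z z) ^ q = herm q z z := fun z => (herm_swap H z z).symm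
  obtain ⟨t, ht⟩ := norm_surj H (-(herm q y' y') / herm q x x)
    (by rw [div_pow, H.neg, hself, hself]) (div_ne_zero (neg_ne_zero.2 hyy) hxx)
  refine ⟨y' + t • x, Submodule.add_mem _ hy'p (Submodule.smul_mem _ _ hx), ?_, ?_⟩
  · intro h
    apply hy'W
    have : y' = (y' + t • x) + (-t) • x := by module
    rw [this]
    exact Submodule.add_mem _ (Submodule.mem_sup_left h) (Submodule.smul_mem _ _
      (Submodule.mem_sup_right (Submodule.mem_span_singleton_self x)))
  · rw [herm_add_left, herm_add_right H, herm_add_right H, herm_smul_left, herm_smul_left,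
      herm_smul_right, herm_smul_right, hy'x, herm_symm_zero H hy'x]
    rw [eq_div_iff hxx, pow_succ] at ht
    linear_combination ht

theorem exists_generator {n : ℕ} (H : HH q F) {x : Fin (2*n+2) → F} (hxx : herm q x x = 0) :
    ∃ μ, IsGenerator q n μ ∧ x ∈ μ := by
  have key : ∀ k, k ≤ n + 1 → ∃ W : Submodule F (Fin (2*n+2) → F), k ≤ Module.finrank F W ∧
      TotallyIsotropic q W ∧ x ∈ W := by
    intro k
    induction k with
    | zero =>
      intro _
      refine ⟨Submodule.span F {x}, Nat.zero_le _, ?_, Submodule.mem_span_singleton_self x⟩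
      intro z hz
      obtain ⟨t, rfl⟩ := Submodule.mem_span_singleton.1 hz
      rw [herm_smul_left, herm_smul_right, hxx]; ring
    | succ k ih =>
      intro hk
      obtain ⟨W, h1, h2, h3⟩ := ih (by omega)
      by_cases hlt : k + 1 ≤ Module.finrank F W
      · exact ⟨W, hlt, h2, h3⟩
      obtain ⟨z, hz, hzW, hzz⟩ := exists_isotropic_ext H h2 (by omega)
      refine ⟨W ⊔ Submodule.span F {z}, ?_, ti_sup H h2 hz hzz, Submodule.mem_sup_left h3⟩
      rw [finrank_sup_span hzW]; omega
  obtain ⟨W, h1, h2, h3⟩ := key (n+1) le_rfl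
  refine ⟨W, ⟨le_antisymm ?_ h1, h2⟩, h3⟩
  have := Submodule.finrank_mono (ti_le_polar H h2)
  have := finrank_polar H W
  omega

theorem gen_polar {n : ℕ} (H : HH q F) {μ : Submodule F (Fin (2*n+2) → F)}
    (h : IsGenerator q n μ) : polar q μ = μ := by
  refine (Submodule.eq_of_le_of_finrank_le (ti_le_polar H h.2) ?_).symm
  have := finrank_polar H μ
  have := h.1
  omega

theorem finrank_inf_polar {n : ℕ} (H : HH q F) {μ W : Submodule F (Fin (2*n+2) → F)}
    (h : IsGenerator q n μ) (hW : Module.finrank F W = n + 1) :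
    Module.finrank F (polar q W ⊓ μ : Submodule F (Fin (2*n+2) → F)) =
    Module.finrank F (W ⊓ μ : Submodule F (Fin (2*n+2) → F)) := by
  have h1 := polar_sup H W μ
  rw [gen_polar H h] at h1
  rw [← h1]
  have h2 := finrank_polar H (W ⊔ μ)
  have h3 := Submodule.finrank_sup_add_finrank_inf_eq W μ
  have := h.1
  omega

end basics


section counting

open Classical

variable {q : ℕ} {F : Type} [Field F] [Fintype F] {m n : ℕ}

theorem finite_submodule : Finite (Submodule F (Fin m → F)) :=
  Finite.of_injective (fun W : Submodule F (Fin m → F) => (W : Set (Fin m → F)))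
    SetLike.coe_injective

noncomputable instance fintypeSubmodule : Fintype (Submodule F (Fin m → F)) :=
  @Fintype.ofFinite _ finite_submodule

theorem cardSub (H : HH q F) (W : Submodule F (Fin m → F)) :
    #{x | x ∈ W} = q ^ (2 * Module.finrank F W) := by
  have h := Module.card_eq_pow_finrank (K := F) (V := W)
  rw [H.card, ← pow_mul] at h
  rw [← h, Fintype.card_subtype]

theorem ti_finrank_le (H : HH q F) {W : Submodule F (Fin (2*n+2) → F)}
    (hW : TotallyIsotropic q W) : Module.finrank F W ≤ n + 1 := by
  have := Submodule.finrank_mono (ti_le_polar H hW)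
  have := finrank_polar H W
  omega

theorem ti_mono {W W' : Submodule F (Fin m → F)} (h : W ≤ W') (hW : TotallyIsotropic q W') :
    TotallyIsotropic q W := fun x hx => hW x (h hx)

theorem finrank_polar_span (H : HH q F) {x : Fin m → F} (hx : x ≠ 0) :
    Module.finrank F (polar q (Submodule.span F {x})) + 1 = m := by
  have := finrank_polar H (Submodule.span F {x})
  rwa [finrank_span_singleton hx] at this

/-- Intersecting with the perp of a vector drops the dimension by at most one. -/
theorem finrank_inf_perp_ge (H : HH q F) (W : Submodule F (Fin m → F)) {x : Fin m → F}
    (hx : x ≠ 0) :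
    Module.finrank F W ≤
      Module.finrank F (W ⊓ polar q (Submodule.span F {x}) : Submodule F (Fin m → F)) + 1 := by
  have h1 := finrank_polar_span H hx
  have h2 := Submodule.finrank_sup_add_finrank_inf_eq W (polar q (Submodule.span F {x}))
  have h3 := Submodule.finrank_le (W ⊔ polar q (Submodule.span F {x}))
  rw [Module.finrank_fin_fun] at h3
  omega

noncomputable def gens (q n : ℕ) {F : Type} [Field F] [Fintype F] (R : Fin (2*n+2) → F) :
    Finset (Submodule F (Fin (2*n+2) → F)) := {μ | IsGenerator q n μ ∧ R ∈ μ}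

theorem mem_gens {R : Fin (2*n+2) → F} {μ} : μ ∈ gens q n R ↔ IsGenerator q n μ ∧ R ∈ μ := by
  simp [gens]

theorem isoCount (H : HH q F) {R U : Fin (2*n+2) → F} (hR : R ≠ 0)
    (hUR : U ∉ Submodule.span F {R}) (hUU : herm q U U = 0) (hUp : herm q U R = 0) :
    q ^ (4*n+2) ≤ #{w : Fin (2*n+2) → F | herm q w R = 0 ∧ herm q w U ≠ 0 ∧ herm q w w = 0} * q
      + q ^ (4*n) := by
  set I : Finset (Fin (2*n+2) → F) := {w | herm q w R = 0 ∧ herm q w U ≠ 0 ∧ herm q w w = 0} with hI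
  set X : Finset (Fin (2*n+2) → F) := {w | herm q w R = 0 ∧ herm q w U ≠ 0} with hX
  have hq := H.two
  have hU0 : U ≠ 0 := fun h => hUR (h ▸ Submodule.zero_mem _)
  have hXc : #X + q ^ (4*n) = q ^ (4*n+2) := by
    have h1 := cardSub H (polar q (Submodule.span F {R}))
    have h2 := cardSub H (polar q (Submodule.span F {R} ⊔ Submodule.span F {U}))
    have h3 := finrank_polar_span H hR
    have h4 := finrank_polar H (Submodule.span F {R} ⊔ Submodule.span F {U})
    rw [finrank_sup_span hUR, finrank_span_singleton hR] at h4
    rw [show 2 * Module.finrank F (polar q (Submodule.span F {R})) = 4*n+2 by omega] at h1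
    rw [show 2 * Module.finrank F (polar q (Submodule.span F {R} ⊔ Submodule.span F {U})) = 4*n
      by omega] at h2
    rw [← h1, ← h2, ← card_union_of_disjoint]
    · congr 1
      ext w
      simp only [hX, mem_union, mem_filter, mem_univ, true_and, polar_sup H, Submodule.mem_inf,
        mem_polar_span]
      tauto
    · rw [disjoint_left]
      intro w
      simp only [hX, mem_filter, mem_univ, true_and, polar_sup H, Submodule.mem_inf,
        mem_polar_span]
      tauto
  have hdc : #X * q ≤ #I * q ^ 2 := by
    apply card_mul_le_card_mul (fun v w => ∃ t : F, w = v + t • U)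
    · intro v hv
      simp only [hX, mem_filter, mem_univ, true_and] at hv
      have hs : herm q U v ≠ 0 := fun h => hv.2 (herm_symm_zero H h)
      have hfib := trace_fiber_ge H (- herm q v v) (by rw [H.neg, ← herm_swap H])
      refine hfib.trans ?_
      refine card_le_card_of_injOn (fun t => v + (t / herm q U v) • U) ?_ ?_
      · intro t ht
        simp only [coe_filter, mem_univ, true_and, Set.mem_ofPred_eq] at ht
        simp only [bipartiteAbove, hI, coe_filter, mem_filter, mem_univ, true_and,
          Set.mem_ofPred_eq]
        refine ⟨⟨?_, ?_, ?_⟩, ⟨_, rfl⟩⟩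
        · rw [herm_add_left, herm_smul_left, hv.1, hUp]; ring
        · rw [herm_add_left, herm_smul_left, hUU, mul_zero, add_zero]; exact hv.2
        · rw [herm_add_left, herm_add_right H, herm_add_right H, herm_smul_left, herm_smul_left,
            herm_smul_right, herm_smul_right, hUU, herm_swap H U v, div_pow,
            div_mul_cancel₀ _ hs, div_mul_cancel₀ _ (pow_ne_zero _ hs)]
          linear_combination ht
      · intro t _ t' _ h
        simp only [add_right_inj] at h
        have := smul_left_injective F hU0 h
        exact (div_left_inj' hs).1 this
    · intro w _
      rw [← H.card, ← card_univ]
      have : (X.bipartiteBelow (fun v w => ∃ t : F, w = v + t • U) w) ⊆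
          univ.image (fun t : F => w - t • U) := by
        intro v hv
        simp only [bipartiteBelow, mem_filter] at hv
        obtain ⟨_, t, rfl⟩ := hv
        rw [mem_image]
        exact ⟨t, mem_univ _, by simp⟩
      exact (card_le_card this).trans card_image_le
  have : #X ≤ #I * q := by
    rw [sq, ← mul_assoc] at hdc
    exact Nat.le_of_mul_le_mul_right hdc (by omega)
  omega

theorem gens_pair (H : HH q F) {R U : Fin (2*n+2) → F} (hR : R ≠ 0)
    (hUR : U ∉ Submodule.span F {R}) :
    #((gens q n R).filter (fun μ => U ∈ μ)) * q ^ (2*n) ≤ #(gens q n R) * q := by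
  set A := (gens q n R).filter (fun μ => U ∈ μ) with hA
  rcases A.eq_empty_or_nonempty with h0 | ⟨μ0, hμ0⟩
  · rw [h0]; simp
  have hq := H.two
  have memA : ∀ {μ}, μ ∈ A ↔ (IsGenerator q n μ ∧ R ∈ μ) ∧ U ∈ μ := by
    intro μ; rw [hA, mem_filter, mem_gens]
  obtain ⟨⟨hg0, hR0⟩, hU0⟩ := memA.1 hμ0
  have hUU : herm q U U = 0 := hg0.2 U hU0
  have hUp : herm q U R = 0 := mem_polar.1 (ti_le_polar H hg0.2 hU0) R hR0
  have hUne : U ≠ 0 := fun h => hUR (h ▸ Submodule.zero_mem _)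
  have hIc := isoCount H hR hUR hUU hUp
  set I : Finset (Fin (2*n+2) → F) := {w | herm q w R = 0 ∧ herm q w U ≠ 0 ∧ herm q w w = 0} with hI
  let nu : Submodule F (Fin (2*n+2) → F) → (Fin (2*n+2) → F) → Submodule F (Fin (2*n+2) → F) :=
    fun μ w => (μ ⊓ polar q (Submodule.span F {w})) ⊔ Submodule.span F {w}
  have hnu : ∀ μ ∈ A, ∀ w ∈ I, IsGenerator q n (nu μ w) ∧ R ∈ nu μ w ∧ w ∈ nu μ w := by
    intro μ hμ w hw
    obtain ⟨⟨hg, hRμ⟩, hUμ⟩ := memA.1 hμ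
    simp only [hI, mem_filter, mem_univ, true_and] at hw
    have hw0 : w ≠ 0 := by
      rintro rfl
      exact hw.2.1 (herm_zero_left _)
    have hti : TotallyIsotropic q (nu μ w) := by
      refine ti_sup H (ti_mono inf_le_left hg.2) ?_ hw.2.2
      rw [mem_polar]
      intro x hx
      exact herm_symm_zero H (mem_polar_span.1 hx.2)
    refine ⟨⟨le_antisymm (ti_finrank_le H hti) ?_, hti⟩, ?_, ?_⟩
    · have hwμ : w ∉ μ ⊓ polar q (Submodule.span F {w}) := by
        intro h
        exact hw.2.1 (mem_polar.1 (ti_le_polar H hg.2 h.1) U hUμ)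
      show _ ≤ Module.finrank F ↥((μ ⊓ polar q (Submodule.span F {w})) ⊔ Submodule.span F {w})
      rw [finrank_sup_span hwμ, ← hg.1]
      exact finrank_inf_perp_ge H μ hw0
    · exact Submodule.mem_sup_left ⟨hRμ, mem_polar_span.2 (herm_symm_zero H hw.1)⟩
    · exact Submodule.mem_sup_right (Submodule.mem_span_singleton_self w)
  have hrec : ∀ μ ∈ A, ∀ w ∈ I,
      μ = (nu μ w ⊓ polar q (Submodule.span F {U})) ⊔ Submodule.span F {U} := by
    intro μ hμ w hw
    obtain ⟨hgn, _, _⟩ := hnu μ hμ w hw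
    obtain ⟨⟨hg, hRμ⟩, hUμ⟩ := memA.1 hμ
    simp only [hI, mem_filter, mem_univ, true_and] at hw
    have hUw : herm q U w ≠ 0 := fun h => hw.2.1 (herm_symm_zero H h)
    apply Submodule.eq_of_le_of_finrank_le
    · intro x hx
      have : x = (x + (-(herm q x w / herm q U w)) • U) + (herm q x w / herm q U w) • U := by module
      rw [this]
      have hy : x + (-(herm q x w / herm q U w)) • U ∈ μ := μ.add_mem hx (μ.smul_mem _ hUμ)
      refine Submodule.add_mem _ (Submodule.mem_sup_left ⟨Submodule.mem_sup_left ⟨hy, ?_⟩, ?_⟩)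
        (Submodule.mem_sup_right (Submodule.smul_mem _ _ (Submodule.mem_span_singleton_self U)))
      · show _ ∈ polar q (Submodule.span F {w})
        rw [mem_polar_span, herm_add_left, herm_smul_left]
        field_simp
        ring
      · show _ ∈ polar q (Submodule.span F {U})
        rw [mem_polar_span]
        exact mem_polar.1 (ti_le_polar H hg.2 hy) U hUμ
    · rw [hg.1]
      apply ti_finrank_le H
      refine ti_sup H (ti_mono inf_le_left hgn.2) ?_ hUU
      rw [mem_polar]
      intro x hx
      exact herm_symm_zero H (mem_polar_span.1 hx.2)
  have hcount : #A * #I ≤ ∑ ν ∈ gens q n R, #{w | w ∈ ν ∧ herm q w U ≠ 0} := by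
    rw [← card_product, ← card_sigma]
    refine card_le_card_of_injOn (fun x => ⟨nu x.1 x.2, x.2⟩) ?_ ?_
    · rintro ⟨μ, w⟩ hx
      rw [mem_coe, mem_product] at hx
      obtain ⟨h1, h2, h3⟩ := hnu μ hx.1 w hx.2
      rw [mem_coe, mem_sigma]
      refine ⟨mem_gens.2 ⟨h1, h2⟩, ?_⟩
      have hw := hx.2
      simp only [hI, mem_filter, mem_univ, true_and] at hw
      simp only [mem_filter, mem_univ, true_and]
      exact ⟨h3, hw.2.1⟩
    · rintro ⟨μ, w⟩ hx ⟨μ', w'⟩ hx' h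
      rw [mem_coe, mem_product] at hx hx'
      simp only [Sigma.mk.injEq, heq_eq_eq] at h
      obtain ⟨h1, rfl⟩ := h
      have e1 := hrec μ hx.1 w hx.2
      have e2 := hrec μ' hx'.1 w hx'.2
      rw [← h1, ← e1] at e2
      rw [e2]
  have hfib : ∀ ν ∈ gens q n R, #{w | w ∈ ν ∧ herm q w U ≠ 0} ≤ q ^ (2*n) * (q^2-1) := by
    intro ν hν
    have hg := (mem_gens.1 hν).1
    have h1 := cardSub H ν
    have h2 := cardSub H (ν ⊓ polar q (Submodule.span F {U}))
    have h3 := finrank_inf_perp_ge H ν hUne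
    rw [hg.1] at h1 h3
    have h4 : q ^ (2*n) ≤ q ^ (2 * Module.finrank F
      (ν ⊓ polar q (Submodule.span F {U}) : Submodule F (Fin (2*n+2) → F))) :=
      Nat.pow_le_pow_right (by omega) (by omega)
    have h5 : #{w | w ∈ ν ∧ herm q w U ≠ 0} + #{x | x ∈ ν ⊓ polar q (Submodule.span F {U})}
        = #{x | x ∈ ν} := by
      rw [← card_union_of_disjoint]
      · congr 1
        ext w
        simp only [mem_union, mem_filter, mem_univ, true_and, Submodule.mem_inf, mem_polar_span]
        tauto
      · rw [disjoint_left]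
        intro w
        simp only [mem_filter, mem_univ, true_and, Submodule.mem_inf, mem_polar_span]
        tauto
    have h6 : q ^ (2 * (n+1)) = q^(2*n) * q^2 := by rw [← pow_add]; ring
    rw [Nat.mul_sub, mul_one]
    omega
  have hcount2 : #A * #I ≤ #(gens q n R) * (q ^ (2*n) * (q^2-1)) := by
    refine hcount.trans ((sum_le_card_nsmul _ _ _ hfib).trans ?_)
    rw [smul_eq_mul]
  have hq2 : 1 ≤ q ^ 2 := Nat.one_le_pow _ _ (by omega)
  have hI2 : q ^ (2*n) * q ^ (2*n) * (q^2-1) ≤ #I * q := by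
    have e1 : q ^ (4*n+2) = q ^ (2*n) * q ^ (2*n) * q^2 := by
      rw [← pow_add, ← pow_add]; congr 1; omega
    have e2 : q ^ (4*n) = q ^ (2*n) * q ^ (2*n) := by
      rw [← pow_add]; congr 1; omega
    rw [Nat.mul_sub, mul_one]
    omega
  have hpos : 0 < q ^ (2*n) * (q^2-1) := by
    apply Nat.mul_pos (by positivity)
    have : 2 ^ 2 ≤ q ^ 2 := Nat.pow_le_pow_left hq 2
    omega
  refine Nat.le_of_mul_le_mul_right ?_ hpos
  calc #A * q ^ (2*n) * (q ^ (2*n) * (q^2-1)) = #A * (q ^ (2*n) * q ^ (2*n) * (q^2-1)) := by ring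
    _ ≤ #A * (#I * q) := Nat.mul_le_mul_left _ hI2
    _ = (#A * #I) * q := by ring
    _ ≤ (#(gens q n R) * (q ^ (2*n) * (q^2-1))) * q := Nat.mul_le_mul_right _ hcount2
    _ = _ := by ring

/-- the main double counting tool -/
theorem count_tool (H : HH q F) {R : Fin (2*n+2) → F} (hR : R ≠ 0)
    (T : Finset (Fin (2*n+2) → F)) (hT : ∀ U ∈ T, U ∉ Submodule.span F {R})
    (G' : Finset (Submodule F (Fin (2*n+2) → F))) (hG' : G' ⊆ gens q n R) (k : ℕ)
    (hk : ∀ μ ∈ G', k ≤ #(T.filter (fun U => U ∈ μ))) :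
    k * #G' * q ^ (2*n) ≤ #T * #(gens q n R) * q := by
  have h1 : #G' * k ≤ ∑ μ ∈ G', #(T.filter (fun U => U ∈ μ)) := by
    have := card_nsmul_le_sum G' _ k hk
    simpa using this
  have h2 : ∑ μ ∈ G', #(T.filter (fun U => U ∈ μ)) = ∑ U ∈ T, #(G'.filter (fun μ => U ∈ μ)) :=
    sum_card_bipartiteAbove_eq_sum_card_bipartiteBelow (fun (μ : Submodule F (Fin (2*n+2) → F))
      (U : Fin (2*n+2) → F) => U ∈ μ)
  have h3 : ∑ U ∈ T, #(G'.filter (fun μ => U ∈ μ)) * q ^ (2*n) ≤ ∑ U ∈ T, #(gens q n R) * q := by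
    refine sum_le_sum fun U hU => le_trans (Nat.mul_le_mul_right _ (card_le_card ?_))
      (gens_pair H hR (hT U hU))
    exact filter_subset_filter _ hG'
  rw [← sum_mul, sum_const, smul_eq_mul] at h3
  calc k * #G' * q ^ (2*n) = (#G' * k) * q ^ (2*n) := by ring
    _ ≤ _ := Nat.mul_le_mul_right _ (h1.trans h2.le)
    _ ≤ _ := h3
    _ = _ := by ring

/-- number of isotropic vectors in a subspace that is not totally isotropic -/
theorem iso_card_le (H : HH q F) {W : Submodule F (Fin m → F)} {k : ℕ}
    (hW : Module.finrank F W = k + 1) (hti : ¬ TotallyIsotropic q W) :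
    #{x | x ∈ W ∧ herm q x x = 0} ≤ (q + 1) * q ^ (2*k) := by
  simp only [TotallyIsotropic, not_forall] at hti
  obtain ⟨x, hx, hxx⟩ := hti
  have hx0 : x ≠ 0 := by rintro rfl; exact hxx (herm_zero_left _)
  -- the hyperplane of `W`
  set W0 := W ⊓ polar q (Submodule.span F {x}) with hW0
  have hxW0 : x ∉ W0 := fun h => hxx (mem_polar_span.1 h.2)
  have hfr : Module.finrank F W0 ≤ k := by
    have h1 := finrank_sup_span hxW0
    have h2 : W0 ⊔ Submodule.span F {x} ≤ W :=
      sup_le inf_le_left ((Submodule.span_singleton_le_iff_mem _ _).2 hx)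
    have := Submodule.finrank_mono h2
    omega
  have hq := H.two
  have hmaps : ∀ v ∈ ({x | x ∈ W ∧ herm q x x = 0} : Finset (Fin m → F)),
      v + (-(herm q v x / herm q x x)) • x ∈ ({y | y ∈ W0} : Finset (Fin m → F)) := by
    intro v hv
    simp only [mem_filter, mem_univ, true_and] at *
    refine ⟨W.add_mem hv.1 (W.smul_mem _ hx), ?_⟩
    show _ ∈ polar q (Submodule.span F {x})
    rw [mem_polar_span, herm_add_left, herm_smul_left]
    field_simp
    ring
  refine (card_le_mul_card_image_of_maps_to hmaps (q + 1) ?_).trans ?_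
  · intro y hy
    simp only [mem_filter, mem_univ, true_and] at hy
    have hyx : herm q y x = 0 := mem_polar_span.1 hy.2
    refine le_trans (card_le_card_of_injOn (fun v => herm q v x / herm q x x)
      (t := ({t : F | t ^ (q+1) = - herm q y y / herm q x x} : Finset F)) ?_ ?_) (norm_fiber_le _)
    · intro v hv
      simp only [mem_coe, mem_filter, mem_univ, true_and] at hv ⊢
      obtain ⟨⟨_, hvv⟩, hvy⟩ := hv
      set t := herm q v x / herm q x x with ht
      have hv' : v = y + t • x := by rw [← hvy]; module
      rw [hv', herm_add_left, herm_add_right H, herm_add_right H, herm_smul_left, herm_smul_left,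
        herm_smul_right, herm_smul_right, hyx, herm_symm_zero H hyx] at hvv
      rw [eq_div_iff hxx, pow_succ]
      linear_combination hvv
    · intro v hv v' hv' h
      simp only [mem_coe, mem_filter, mem_univ, true_and] at hv hv' h
      have h2 := hv.2.trans hv'.2.symm
      rw [h] at h2
      exact add_right_cancel h2
  · rw [cardSub H]
    exact Nat.mul_le_mul_left _ (Nat.pow_le_pow_right (by omega) (by omega))

end counting

section vectorwords

open Classical

variable {p q : ℕ} {F : Type} [Field F] [Fintype F] {n : ℕ}

/-- vector version of a code word -/
structure VC (p q n : ℕ) {F : Type} [Field F] [Fintype F] (f : (Fin (2*n+2) → F) → ZMod p) :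
    Prop where
  zero : f 0 = 0
  iso : ∀ x, f x ≠ 0 → herm q x x = 0
  smul : ∀ (a : F) x, a ≠ 0 → f (a • x) = f x
  sum : ∀ μ : Submodule F (Fin (2*n+2) → F), IsGenerator q n μ → ∑ x with x ∈ μ, f x = 0

theorem VC.ne {f : (Fin (2*n+2) → F) → ZMod p} (hf : VC p q n f) {x} (hx : f x ≠ 0) : x ≠ 0 := by
  rintro rfl; exact hx hf.zero

theorem sum_line (H : HH q F) (hpq : (q : ZMod p) = 0) {f : (Fin (2*n+2) → F) → ZMod p}
    (hf : VC p q n f) {R : Fin (2*n+2) → F} (hR : R ≠ 0) :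
    ∑ x with x ∈ Submodule.span F {R}, f x = - f R := by
  have himg : ({x | x ∈ Submodule.span F {R}} : Finset (Fin (2*n+2) → F)) =
      univ.image (fun a : F => a • R) := by
    ext x
    simp [Submodule.mem_span_singleton]
  rw [himg, sum_image (fun a _ b _ h => smul_left_injective F hR h),
    ← add_sum_erase _ _ (mem_univ (0 : F)), zero_smul, hf.zero, zero_add,
    sum_congr rfl (g := fun _ => f R) (fun a ha => hf.smul a R (ne_of_mem_erase ha)),
    sum_const, card_erase_of_mem (mem_univ _), card_univ, H.card, nsmul_eq_mul,
    Nat.cast_sub (Nat.one_le_pow _ _ (by have := H.two; omega))]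
  push_cast
  rw [hpq]
  ring

theorem cone_count (H : HH q F) (T : Finset (Fin (2*n+2) → F))
    (hT : ∀ (a : F) x, a ≠ 0 → x ∈ T → a • x ∈ T) (μ : Submodule F (Fin (2*n+2) → F))
    {x : Fin (2*n+2) → F} (hx0 : x ≠ 0) (hxT : x ∈ T) (hxμ : x ∈ μ) :
    q ^ 2 - 1 ≤ #(T.filter (fun U => U ∈ μ)) := by
  rw [← H.card, ← card_univ, ← card_erase_of_mem (mem_univ (0:F))]
  refine card_le_card_of_injOn (fun a => a • x) ?_ ?_
  · intro a ha
    have ha' : a ≠ 0 := ne_of_mem_erase (mem_coe.1 ha)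
    rw [mem_coe, mem_filter]
    exact ⟨hT a x ha' hxT, μ.smul_mem _ hxμ⟩
  · intro a _ b _ h
    exact smul_left_injective F hx0 h

theorem gens_pos (H : HH q F) {R : Fin (2*n+2) → F} (hR : herm q R R = 0) : 0 < #(gens q n R) := by
  obtain ⟨μ, h1, h2⟩ := exists_generator H hR
  exact card_pos.2 ⟨μ, mem_gens.2 ⟨h1, h2⟩⟩

theorem smul_mem_span_iff {R x : Fin (2*n+2) → F} {a : F} (ha : a ≠ 0) :
    a • x ∈ Submodule.span F {R} ↔ x ∈ Submodule.span F {R} :=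
  (Submodule.span F {R}).smul_mem_iff ha

theorem degree_ge (H : HH q F) (hpq : (q : ZMod p) = 0) {f : (Fin (2*n+2) → F) → ZMod p}
    (hf : VC p q n f) {R : Fin (2*n+2) → F} (hR : f R ≠ 0) :
    q ^ (2*n+1) ≤ 2 * #{U | f U ≠ 0 ∧ herm q U R = 0} := by
  have hq := H.two
  have hR0 := hf.ne hR
  set T : Finset (Fin (2*n+2) → F) :=
    {U | f U ≠ 0 ∧ herm q U R = 0 ∧ U ∉ Submodule.span F {R}} with hT
  have h1 := count_tool H hR0 T (fun U hU => by
      simp only [hT, mem_filter] at hU; exact hU.2.2.2) (gens q n R) subset_rfl (q^2-1) (by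
    intro μ hμ
    obtain ⟨hg, hRμ⟩ := mem_gens.1 hμ
    have hex : ∃ U ∈ μ, f U ≠ 0 ∧ U ∉ Submodule.span F {R} := by
      by_contra hcon
      push Not at hcon
      have hs := hf.sum μ hg
      rw [← sum_subset (s₁ := ({x | x ∈ Submodule.span F {R}} : Finset (Fin (2*n+2) → F))),
        sum_line H hpq hf hR0] at hs
      · exact hR (neg_eq_zero.1 hs)
      · intro x hx
        simp only [mem_filter, mem_univ, true_and] at *
        exact (Submodule.span_singleton_le_iff_mem _ _).2 hRμ hx
      · intro x hx hx'
        simp only [mem_filter, mem_univ, true_and] at *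
        by_contra hne
        exact hx' (hcon x hx hne)
    obtain ⟨U, hUμ, hU, hUR⟩ := hex
    refine cone_count H T ?_ μ (hf.ne hU) ?_ hUμ
    · intro a x ha hx
      simp only [hT, mem_filter, mem_univ, true_and] at *
      rw [hf.smul a x ha, herm_smul_left, smul_mem_span_iff ha, hx.2.1]
      exact ⟨hx.1, mul_zero _, hx.2.2⟩
    · simp only [hT, mem_filter, mem_univ, true_and]
      exact ⟨hU, mem_polar.1 (ti_le_polar H hg.2 hUμ) R hRμ, hUR⟩)
  have hg := gens_pos H (n := n) (hf.iso R hR)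
  have h2 : (q^2-1) * q ^ (2*n) ≤ #T * q := by
    refine Nat.le_of_mul_le_mul_right ?_ hg
    calc _ = _ := by ring
      _ ≤ _ := h1
      _ = _ := by ring
  have h3 : #T ≤ #{U | f U ≠ 0 ∧ herm q U R = 0} := by
    apply card_le_card
    intro x hx
    simp only [hT, mem_filter, mem_univ, true_and] at *
    exact ⟨hx.1, hx.2.1⟩
  have h4 : 2 ^ 2 ≤ q ^ 2 := Nat.pow_le_pow_left hq 2
  have h5 : q ^ (2*n+1) * q ≤ (2 * #T) * q := by
    calc q ^ (2*n+1) * q = q ^ 2 * q ^ (2*n) := by ring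
      _ ≤ (2 * (q^2-1)) * q ^ (2*n) := Nat.mul_le_mul_right _ (by omega)
      _ = 2 * ((q^2-1) * q ^ (2*n)) := by ring
      _ ≤ 2 * (#T * q) := Nat.mul_le_mul_left _ h2
      _ = _ := by ring
  have h6 := Nat.le_of_mul_le_mul_right h5 (by omega)
  omega

theorem exists_heavy (H : HH q F) (hpq : (q : ZMod p) = 0) {f : (Fin (2*n+2) → F) → ZMod p}
    (hf : VC p q n f) (hne : ∃ x, f x ≠ 0) (hq4 : 4 ≤ q) {δ : ℝ} (hδ : 0 < δ)
    (hS : (#{x | f x ≠ 0} : ℝ) ≤ δ * (q:ℝ) ^ (2*n+1)) :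
    ∀ k, k ≤ n + 1 → ∃ X : Submodule F (Fin (2*n+2) → F), Module.finrank F X = k ∧
      (1/2) * (1/(4*δ))^k * (q:ℝ) ^ (2*n+1) ≤ #{x | f x ≠ 0 ∧ x ∈ polar q X} := by
  have hqpos : (0:ℝ) < q := by exact_mod_cast (by omega : 0 < q)
  have hq4' : (4:ℝ) ≤ q := by exact_mod_cast hq4
  intro k
  induction k with
  | zero =>
    intro _
    obtain ⟨x, hx⟩ := hne
    refine ⟨⊥, finrank_bot _ _, ?_⟩
    have h1 := degree_ge H hpq hf hx
    have h2 : #{U | f U ≠ 0 ∧ herm q U x = 0} ≤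
        #{x | f x ≠ 0 ∧ x ∈ polar q (⊥ : Submodule F (Fin (2*n+2) → F))} := by
      apply card_le_card
      intro y hy
      simp only [mem_filter, mem_univ, true_and] at *
      refine ⟨hy.1, ?_⟩
      rw [mem_polar]
      intro z hz
      rw [(Submodule.mem_bot F).1 hz, herm_zero_right H]
    have h3 : ((q ^ (2*n+1) : ℕ) : ℝ) ≤
        ((2 * #{x | f x ≠ 0 ∧ x ∈ polar q (⊥ : Submodule F (Fin (2*n+2) → F))} : ℕ) : ℝ) := by
      exact_mod_cast h1.trans (Nat.mul_le_mul_left _ h2)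
    push_cast at h3
    linarith
  | succ k ih =>
    intro hk
    obtain ⟨X, hX, hXc⟩ := ih (by omega)
    set T : Finset (Fin (2*n+2) → F) := {x | f x ≠ 0 ∧ x ∈ polar q X} with hT
    set Z : Finset (Fin (2*n+2) → F) := {x | f x ≠ 0 ∧ x ∉ X} with hZ
    have hTpos : (0:ℝ) < #T := lt_of_lt_of_le (by positivity) hXc
    have hZS : (#Z : ℝ) ≤ δ * (q:ℝ) ^ (2*n+1) := by
      refine le_trans ?_ hS
      have : #Z ≤ #{x | f x ≠ 0} := by
        apply card_le_card
        intro x hx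
        simp only [hZ, mem_filter, mem_univ, true_and] at *
        exact hx.1
      exact_mod_cast this
    have hdeg : ∀ y ∈ T, (q:ℝ) ^ (2*n+1) / 4 ≤ #(Z.filter (fun z => herm q y z = 0)) := by
      intro y hy
      simp only [hT, mem_filter, mem_univ, true_and] at hy
      have h1 := degree_ge H hpq hf hy.1
      have h2 : #{U | f U ≠ 0 ∧ herm q U y = 0} ≤
          #(Z.filter (fun z => herm q y z = 0)) + #{x | x ∈ X} := by
        refine le_trans (card_le_card ?_) (card_union_le _ _)
        intro z hz
        simp only [hZ, mem_union, mem_filter, mem_univ, true_and] at *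
        by_cases hzX : z ∈ X
        · exact Or.inr hzX
        · exact Or.inl ⟨⟨hz.1, hzX⟩, herm_symm_zero H hz.2⟩
      have h3 : #{x | x ∈ X} ≤ q ^ (2*n) := by
        rw [cardSub H]
        exact Nat.pow_le_pow_right (by omega) (by omega)
      have h4 : ((q ^ (2*n+1) : ℕ) : ℝ) ≤
          ((2 * (#(Z.filter (fun z => herm q y z = 0)) + q ^ (2*n)) : ℕ) : ℝ) := by
        exact_mod_cast (by omega)
      push_cast at h4
      have h5 : (4:ℝ) * q ^ (2*n) ≤ q ^ (2*n+1) := by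
        rw [pow_succ, mul_comm]
        exact mul_le_mul_of_nonneg_left hq4' (by positivity)
      linarith
    have hswap : ∑ y ∈ T, #(Z.filter (fun z => herm q y z = 0)) =
        ∑ z ∈ Z, #(T.filter (fun y => herm q y z = 0)) :=
      sum_card_bipartiteAbove_eq_sum_card_bipartiteBelow (fun y z => herm q y z = 0)
    have hsum : (#T : ℝ) * ((q:ℝ) ^ (2*n+1) / 4) ≤
        ∑ z ∈ Z, (#(T.filter (fun y => herm q y z = 0)) : ℝ) := by
      have h1 := card_nsmul_le_sum T (fun y => (#(Z.filter (fun z => herm q y z = 0)) : ℝ)) _ hdeg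
      rw [nsmul_eq_mul] at h1
      refine h1.trans (le_of_eq ?_)
      exact_mod_cast hswap
    have hZne : Z.Nonempty := by
      by_contra hcon
      rw [not_nonempty_iff_eq_empty] at hcon
      rw [hcon, sum_empty] at hsum
      have : (0:ℝ) < #T * ((q:ℝ) ^ (2*n+1) / 4) := by positivity
      linarith
    obtain ⟨z, hz, hzc⟩ := exists_le_of_sum_le (f := fun _ => (#T : ℝ) * (1/(4*δ))) hZne (by
      refine le_trans ?_ hsum
      rw [sum_const, nsmul_eq_mul]
      calc (#Z : ℝ) * (#T * (1/(4*δ))) ≤ (δ * (q:ℝ) ^ (2*n+1)) * (#T * (1/(4*δ))) :=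
            mul_le_mul_of_nonneg_right hZS (by positivity)
        _ = _ := by field_simp)
    simp only [hZ, mem_filter, mem_univ, true_and] at hz
    refine ⟨X ⊔ Submodule.span F {z}, by rw [finrank_sup_span hz.2, hX], ?_⟩
    have heq : ({x | f x ≠ 0 ∧ x ∈ polar q (X ⊔ Submodule.span F {z})} : Finset _) =
        T.filter (fun y => herm q y z = 0) := by
      ext y
      simp only [hT, mem_filter, mem_univ, true_and, polar_sup H, Submodule.mem_inf,
        mem_polar_span, and_assoc]
    rw [heq]
    refine le_trans ?_ hzc
    calc _ = ((1/2) * (1/(4*δ))^k * (q:ℝ) ^ (2*n+1)) * (1/(4*δ)) := by ring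
      _ ≤ _ := mul_le_mul_of_nonneg_right hXc (by positivity)

end vectorwords

section reduction

open Classical

variable {p q : ℕ} {F : Type} [Field F] [Fintype F] {n : ℕ}

theorem exists_light (H : HH q F) {f : (Fin (2*n+2) → F) → ZMod p}
    {δ ε : ℝ} (hδ : 0 < δ) (hε : 0 < ε)
    (hS : (#{x | f x ≠ 0} : ℝ) ≤ δ * (q:ℝ) ^ (2*n+1))
    {W : Submodule F (Fin (2*n+2) → F)} (hW : Module.finrank F W = n + 1)
    (B : Finset (Fin (2*n+2) → F)) (hB : ∀ x ∈ B, f x ≠ 0 ∧ x ∈ W)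
    (hBc : ε * (q:ℝ) ^ (2*n+1) ≤ #B) :
    ∃ R ∈ B, ε * #{U | (f U ≠ 0 ∧ U ∉ W ∧ U ∉ polar q W) ∧ herm q R U = 0} ≤ δ * (q:ℝ) ^ (2*n) := by
  have hq := H.two
  have hqpos : (0:ℝ) < q := by exact_mod_cast (by omega : 0 < q)
  set Y : Finset (Fin (2*n+2) → F) := {U | f U ≠ 0 ∧ U ∉ W ∧ U ∉ polar q W} with hY
  have hYe : ∀ R, ({U | (f U ≠ 0 ∧ U ∉ W ∧ U ∉ polar q W) ∧ herm q R U = 0} : Finset _) =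
      Y.filter (fun U => herm q R U = 0) := by
    intro R; rw [hY, filter_filter]
  simp only [hYe]
  have hYc : (#Y : ℝ) ≤ δ * (q:ℝ) ^ (2*n+1) := by
    refine le_trans ?_ hS
    have : #Y ≤ #{x | f x ≠ 0} := by
      apply card_le_card
      intro x hx
      simp only [hY, mem_filter, mem_univ, true_and] at *
      exact hx.1
    exact_mod_cast this
  have hswap : ∑ R ∈ B, #(Y.filter (fun U => herm q R U = 0)) =
      ∑ U ∈ Y, #(B.filter (fun R => herm q R U = 0)) :=
    sum_card_bipartiteAbove_eq_sum_card_bipartiteBelow (fun R U => herm q R U = 0)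
  have hsm : ∀ U ∈ Y, #(B.filter (fun R => herm q R U = 0)) ≤ q ^ (2*n) := by
    intro U hU
    simp only [hY, mem_filter, mem_univ, true_and] at hU
    have h1 : #(B.filter (fun R => herm q R U = 0)) ≤
        #{x | x ∈ W ⊓ polar q (Submodule.span F {U})} := by
      apply card_le_card
      intro x hx
      simp only [mem_filter, mem_univ, true_and, Submodule.mem_inf, mem_polar_span] at *
      exact ⟨(hB x hx.1).2, hx.2⟩
    rw [cardSub H] at h1
    refine h1.trans (Nat.pow_le_pow_right (by omega) ?_)
    have hlt : W ⊓ polar q (Submodule.span F {U}) < W := by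
      refine lt_of_le_of_ne inf_le_left ?_
      intro h
      apply hU.2.2
      rw [mem_polar' H]
      intro x hx
      rw [← h] at hx
      exact mem_polar_span.1 hx.2
    have := Submodule.finrank_lt_finrank_of_lt hlt
    omega
  have htot : (∑ R ∈ B, (#(Y.filter (fun U => herm q R U = 0)) : ℝ)) ≤
      δ * (q:ℝ) ^ (2*n+1) * (q:ℝ) ^ (2*n) := by
    have h1 : ∑ R ∈ B, #(Y.filter (fun U => herm q R U = 0)) ≤ #Y * q ^ (2*n) := by
      rw [hswap]
      have := sum_le_card_nsmul Y _ _ hsm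
      simpa using this
    have h2 : (∑ R ∈ B, (#(Y.filter (fun U => herm q R U = 0)) : ℝ)) ≤ #Y * (q:ℝ) ^ (2*n) := by
      exact_mod_cast h1
    exact h2.trans (mul_le_mul_of_nonneg_right hYc (by positivity))
  have hBne : B.Nonempty := by
    rw [← card_pos]
    have : (0:ℝ) < #B := lt_of_lt_of_le (by positivity) hBc
    exact_mod_cast this
  refine exists_le_of_sum_le hBne ?_
  rw [← mul_sum, sum_const, nsmul_eq_mul]
  calc ε * ∑ R ∈ B, (#(Y.filter (fun U => herm q R U = 0)) : ℝ)
      ≤ ε * (δ * (q:ℝ) ^ (2*n+1) * (q:ℝ) ^ (2*n)) := mul_le_mul_of_nonneg_left htot hε.le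
    _ = (ε * (q:ℝ) ^ (2*n+1)) * (δ * (q:ℝ) ^ (2*n)) := by ring
    _ ≤ _ := mul_le_mul_of_nonneg_right hBc (by positivity)

/-- A generator through `R` meeting `W` only in `R` and having no support outside `W`, `W^σ`. -/
theorem good_gen (H : HH q F) (hpq : (q : ZMod p) = 0) {f : (Fin (2*n+2) → F) → ZMod p}
    (hf : VC p q n f)
    {W : Submodule F (Fin (2*n+2) → F)} (hW : Module.finrank F W = n + 1)
    {R : Fin (2*n+2) → F} (hfR : f R ≠ 0) (hRW : R ∈ W)
    {μ : Submodule F (Fin (2*n+2) → F)} (hg : IsGenerator q n μ) (hRμ : R ∈ μ)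
    (h1 : ∀ w ∈ W, w ∈ μ → w ∈ Submodule.span F {R})
    (h2 : ∀ U ∈ μ, f U ≠ 0 → U ∈ W ∨ U ∈ polar q W) :
    R ∉ polar q W ∧ ∃ T, T ∈ polar q W ∧ T ∈ μ ∧ f T = - f R := by
  have hR0 := hf.ne hfR
  have hWμ : W ⊓ μ = Submodule.span F {R} := by
    apply le_antisymm
    · rintro x ⟨hx1, hx2⟩
      exact h1 x hx1 hx2
    · exact (Submodule.span_singleton_le_iff_mem _ _).2 ⟨hRW, hRμ⟩
  have hfr := finrank_inf_polar H hg hW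
  rw [hWμ, finrank_span_singleton hR0] at hfr
  obtain ⟨T, hT0, hTs⟩ := finrank_eq_one_iff'.1 hfr
  have hspan : polar q W ⊓ μ = Submodule.span F {(T : Fin (2*n+2) → F)} := by
    apply le_antisymm
    · intro x hx
      obtain ⟨c, hc⟩ := hTs ⟨x, hx⟩
      rw [Submodule.mem_span_singleton]
      exact ⟨c, congrArg Subtype.val hc⟩
    · exact (Submodule.span_singleton_le_iff_mem _ _).2 T.2
  obtain ⟨T, hTW, hTμ⟩ := T
  simp only at hspan
  have hT0 : T ≠ 0 := fun h => hT0 (by ext1; exact h)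
  have hs := hf.sum μ hg
  have hsub : ∀ {v}, v ∈ μ → Submodule.span F {v} ≤ μ :=
    fun hv => (Submodule.span_singleton_le_iff_mem _ _).2 hv
  have hsupp : ∀ U ∈ μ, f U ≠ 0 → U ∈ Submodule.span F {R} ∨ U ∈ Submodule.span F {T} := by
    intro U hU hfU
    rcases h2 U hU hfU with h | h
    · exact Or.inl (h1 U h hU)
    · right; rw [← hspan]; exact ⟨h, hU⟩
  by_cases hTR : T ∈ Submodule.span F {R}
  · exfalso
    have hle : Submodule.span F {T} ≤ Submodule.span F {R} :=
      (Submodule.span_singleton_le_iff_mem _ _).2 hTR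
    rw [← sum_subset (s₁ := ({x | x ∈ Submodule.span F {R}} : Finset (Fin (2*n+2) → F))),
        sum_line H hpq hf hR0] at hs
    · exact hfR (neg_eq_zero.1 hs)
    · intro x hx
      simp only [mem_filter, mem_univ, true_and] at *
      exact hsub hRμ hx
    · intro x hx hx'
      simp only [mem_filter, mem_univ, true_and] at *
      by_contra hne
      rcases hsupp x hx hne with h | h
      · exact hx' h
      · exact hx' (hle h)
  · refine ⟨?_, T, hTW, hTμ, ?_⟩
    · intro hRp
      apply hTR
      have : R ∈ Submodule.span F {T} := by rw [← hspan]; exact ⟨hRp, hRμ⟩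
      obtain ⟨c, hc⟩ := Submodule.mem_span_singleton.1 this
      have hc0 : c ≠ 0 := by rintro rfl; exact hR0 (by rw [← hc, zero_smul])
      rw [Submodule.mem_span_singleton]
      exact ⟨c⁻¹, by rw [← hc, smul_smul, inv_mul_cancel₀ hc0, one_smul]⟩
    · rw [← sum_subset (s₁ := ({x | x ∈ Submodule.span F {R}} : Finset (Fin (2*n+2) → F)) ∪
          ({x | x ∈ Submodule.span F {T}} : Finset (Fin (2*n+2) → F)))] at hs
      · have h3 := sum_union_inter
          (s₁ := ({x | x ∈ Submodule.span F {R}} : Finset (Fin (2*n+2) → F)))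
          (s₂ := ({x | x ∈ Submodule.span F {T}} : Finset (Fin (2*n+2) → F))) (f := f)
        rw [hs, sum_line H hpq hf hR0, sum_line H hpq hf hT0, sum_eq_zero] at h3
        · linear_combination h3
        · intro x hx
          simp only [mem_inter, mem_filter, mem_univ, true_and] at hx
          obtain ⟨c, rfl⟩ := Submodule.mem_span_singleton.1 hx.2
          by_cases hc : c = 0
          · rw [hc, zero_smul, hf.zero]
          · exact absurd ((smul_mem_span_iff hc).1 hx.1) hTR
      · intro x hx
        simp only [mem_union, mem_filter, mem_univ, true_and] at *
        rcases hx with hx | hx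
        · exact hsub hRμ hx
        · exact hsub hTμ hx
      · intro x hx hx'
        simp only [mem_union, mem_filter, mem_univ, true_and] at *
        by_contra hne
        exact hx' (hsupp x hx hne)

theorem key_step (H : HH q F) (hpq : (q : ZMod p) = 0) {f : (Fin (2*n+2) → F) → ZMod p}
    (hf : VC p q n f) {δ ε : ℝ} (hδ : 0 < δ) (hε : 0 < ε)
    (hS : (#{x | f x ≠ 0} : ℝ) ≤ δ * (q:ℝ) ^ (2*n+1))
    {W : Submodule F (Fin (2*n+2) → F)} (hW : Module.finrank F W = n + 1)
    (B : Finset (Fin (2*n+2) → F)) (hB : ∀ x ∈ B, f x ≠ 0 ∧ x ∈ W)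
    (hBc : ε * (q:ℝ) ^ (2*n+1) ≤ #B) (hqC : 2 + δ / ε ≤ q) :
    ∃ R ∈ B, R ∉ polar q W ∧
      (q:ℝ) ^ (2*n+1) - (2 + δ/ε) * (q:ℝ) ^ (2*n) ≤ #{T | T ∈ polar q W ∧ f T = - f R} := by
  have hq := H.two
  have hqpos : (0:ℝ) < q := by exact_mod_cast (by omega : 0 < q)
  have hq2 : (2:ℝ) ≤ q := by exact_mod_cast hq
  obtain ⟨R, hRB, hRl⟩ := exists_light H hδ hε hS hW B hB hBc
  obtain ⟨hfR, hRW⟩ := hB R hRB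
  have hR0 := hf.ne hfR
  refine ⟨R, hRB, ?_⟩
  set T2 : Finset (Fin (2*n+2) → F) :=
    {U | (f U ≠ 0 ∧ U ∉ W ∧ U ∉ polar q W) ∧ herm q R U = 0} with hT2
  set G := gens q n R with hG
  have hGpos : (0:ℝ) < #G := by exact_mod_cast gens_pos H (n := n) (hf.iso R hfR)
  have hsq1 : 1 ≤ q ^ 2 := Nat.one_le_pow _ _ (by omega)
  -- first kind of bad generators
  set b1 := G.filter (fun μ => ∃ w ∈ W, w ∈ μ ∧ w ∉ Submodule.span F {R}) with hb1
  set b2 := G.filter (fun μ => ∃ U ∈ μ, f U ≠ 0 ∧ U ∉ W ∧ U ∉ polar q W) with hb2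
  set G0 := G.filter (fun μ => (∀ w ∈ W, w ∈ μ → w ∈ Submodule.span F {R}) ∧
    (∀ U ∈ μ, f U ≠ 0 → U ∈ W ∨ U ∈ polar q W)) with hG0
  have hcover : #G ≤ #b1 + #b2 + #G0 := by
    have : G ⊆ (b1 ∪ b2) ∪ G0 := by
      intro μ hμ
      simp only [hb1, hb2, hG0, mem_union, mem_filter]
      by_cases h1 : ∃ w ∈ W, w ∈ μ ∧ w ∉ Submodule.span F {R}
      · exact Or.inl (Or.inl ⟨hμ, h1⟩)
      by_cases h2 : ∃ U ∈ μ, f U ≠ 0 ∧ U ∉ W ∧ U ∉ polar q W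
      · exact Or.inl (Or.inr ⟨hμ, h2⟩)
      refine Or.inr ⟨hμ, ?_, ?_⟩
      · push Not at h1; exact h1
      · push Not at h2
        intro U hU hfU
        by_cases hUW : U ∈ W
        · exact Or.inl hUW
        · exact Or.inr (h2 U hU hfU hUW)
    exact (card_le_card this).trans ((card_union_le _ _).trans
      (Nat.add_le_add_right (card_union_le _ _) _))
  -- count bad generators
  have hc1 : ((q:ℝ)^2 - 1) * #b1 ≤ q * #G := by
    have h := count_tool H hR0 ({w | w ∈ W ∧ w ∉ Submodule.span F {R}} : Finset _)
      (fun U hU => by simp only [mem_filter] at hU; exact hU.2.2) b1 (filter_subset _ _)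
      (q^2 * (q^2-1)) (by
        intro μ hμ
        simp only [hb1, mem_filter] at hμ
        obtain ⟨hμG, w, hwW, hwμ, hwR⟩ := hμ
        obtain ⟨hg, hRμ⟩ := mem_gens.1 hμG
        have hlt : Submodule.span F {R} ⊔ Submodule.span F {w} ≤ W ⊓ μ :=
          sup_le ((Submodule.span_singleton_le_iff_mem _ _).2 ⟨hRW, hRμ⟩)
            ((Submodule.span_singleton_le_iff_mem _ _).2 ⟨hwW, hwμ⟩)
        have hfr := Submodule.finrank_mono hlt
        rw [finrank_sup_span hwR, finrank_span_singleton hR0] at hfr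
        have hc := cardSub H (W ⊓ μ)
        have hcR := cardSub H (Submodule.span F {R})
        rw [finrank_span_singleton hR0] at hcR
        have hpow : q ^ 4 ≤ q ^ (2 * Module.finrank F
            (W ⊓ μ : Submodule F (Fin (2*n+2) → F))) :=
          Nat.pow_le_pow_right (by omega) (by omega)
        have hle : #{x | x ∈ W ⊓ μ} ≤
            #((({w | w ∈ W ∧ w ∉ Submodule.span F {R}} : Finset _)).filter (fun U => U ∈ μ)) +
            #{x | x ∈ Submodule.span F {R}} := by
          refine le_trans (card_le_card ?_) (card_union_le _ _)
          intro x hx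
          simp only [mem_union, mem_filter, mem_univ, true_and, Submodule.mem_inf] at *
          by_cases hxR : x ∈ Submodule.span F {R}
          · exact Or.inr hxR
          · exact Or.inl ⟨⟨hx.1, hxR⟩, hx.2⟩
        have e : q ^ 4 = q ^ 2 * q ^ 2 := by ring
        rw [Nat.mul_sub, mul_one, ← e]
        rw [mul_one] at hcR
        omega)
    have hTc : #{w | w ∈ W ∧ w ∉ Submodule.span F {R}} ≤ q ^ (2*n+2) := by
      have := cardSub H W
      rw [hW] at this
      refine le_trans ?_ this.le
      apply card_le_card
      intro x hx
      simp only [mem_filter, mem_univ, true_and] at *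
      exact hx.1
    have h' : (q^2 * (q^2-1)) * #b1 * q ^ (2*n) ≤ q ^ (2*n+2) * #G * q :=
      h.trans (Nat.mul_le_mul_right _ (Nat.mul_le_mul_right _ hTc))
    have h'' : ((q:ℝ)^2 * ((q:ℝ)^2-1)) * #b1 * (q:ℝ) ^ (2*n) ≤ (q:ℝ) ^ (2*n+2) * #G * q := by
      have := (Nat.cast_le (α := ℝ)).2 h'
      push_cast [Nat.cast_sub hsq1] at this
      exact this
    have hpos : (0:ℝ) < (q:ℝ) ^ (2*n+2) := by positivity
    refine le_of_mul_le_mul_right ?_ hpos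
    calc _ = _ := by ring
      _ ≤ _ := h''
      _ = _ := by ring
  have hc2 : ((q:ℝ)^2 - 1) * #b2 ≤ (δ/ε) * q * #G := by
    have h := count_tool H hR0 T2 (fun U hU hUR => by
        simp only [hT2, mem_filter] at hU
        exact hU.2.1.2.1 ((Submodule.span_singleton_le_iff_mem _ _).2 hRW hUR))
      b2 (filter_subset _ _) (q^2-1) (by
        intro μ hμ
        simp only [hb2, mem_filter] at hμ
        obtain ⟨hμG, U, hUμ, hfU, hU⟩ := hμ
        obtain ⟨hg, hRμ⟩ := mem_gens.1 hμG
        refine cone_count H T2 ?_ μ (hf.ne hfU) ?_ hUμ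
        · intro a x ha hx
          simp only [hT2, mem_filter, mem_univ, true_and] at *
          rw [hf.smul a x ha, herm_smul_right, W.smul_mem_iff ha, (polar q W).smul_mem_iff ha, hx.2]
          exact ⟨hx.1, mul_zero _⟩
        · simp only [hT2, mem_filter, mem_univ, true_and]
          exact ⟨⟨hfU, hU⟩, mem_polar.1 (ti_le_polar H hg.2 hRμ) U hUμ⟩)
    have h'' : ((q:ℝ)^2-1) * #b2 * (q:ℝ) ^ (2*n) ≤ #T2 * #G * q := by
      have := (Nat.cast_le (α := ℝ)).2 h
      push_cast [Nat.cast_sub hsq1] at this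
      exact this
    have hT2c : (#T2 : ℝ) ≤ (δ/ε) * (q:ℝ) ^ (2*n) := by
      rw [div_mul_eq_mul_div, le_div_iff₀ hε]; linarith
    have hpos : (0:ℝ) < (q:ℝ) ^ (2*n) := by positivity
    refine le_of_mul_le_mul_right ?_ hpos
    calc _ ≤ _ := h''
      _ ≤ ((δ/ε) * (q:ℝ) ^ (2*n)) * #G * q :=
        mul_le_mul_of_nonneg_right (mul_le_mul_of_nonneg_right hT2c hGpos.le) hqpos.le
      _ = _ := by ring
  have hcover' : (#G : ℝ) ≤ #b1 + #b2 + #G0 := by exact_mod_cast hcover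
  have hG0c : ((q:ℝ)^2 - 1 - q - (δ/ε) * q) * #G ≤ ((q:ℝ)^2 - 1) * #G0 := by
    have hsq : (0:ℝ) ≤ (q:ℝ)^2 - 1 := by nlinarith
    have := mul_le_mul_of_nonneg_left hcover' hsq
    nlinarith
  have hCpos : (0:ℝ) < (q:ℝ)^2 - 1 - q - (δ/ε) * q := by nlinarith
  have hgood : ∀ μ ∈ G0, R ∉ polar q W ∧ ∃ T, T ∈ polar q W ∧ T ∈ μ ∧ f T = - f R := by
    intro μ hμ
    simp only [hG0, mem_filter] at hμ
    obtain ⟨hμG, h1, h2⟩ := hμ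
    obtain ⟨hg, hRμ⟩ := mem_gens.1 hμG
    exact good_gen H hpq hf hW hfR hRW hg hRμ h1 h2
  have hRp : R ∉ polar q W := by
    have : G0.Nonempty := by
      by_contra hcon
      rw [not_nonempty_iff_eq_empty] at hcon
      rw [hcon, card_empty, Nat.cast_zero, mul_zero] at hG0c
      have := mul_pos hCpos hGpos
      linarith
    obtain ⟨μ, hμ⟩ := this
    exact (hgood μ hμ).1
  refine ⟨hRp, ?_⟩
  set A : Finset (Fin (2*n+2) → F) := {T | T ∈ polar q W ∧ f T = - f R} with hA
  have hneg : - f R ≠ 0 := neg_ne_zero.2 hfR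
  have h := count_tool H hR0 A (fun U hU hUR => by
      simp only [hA, mem_filter, mem_univ, true_and] at hU
      obtain ⟨c, rfl⟩ := Submodule.mem_span_singleton.1 hUR
      have hc0 : c ≠ 0 := by
        rintro rfl
        rw [zero_smul, hf.zero] at hU
        exact hneg hU.2.symm
      exact hRp (((polar q W).smul_mem_iff hc0).1 hU.1))
    G0 (filter_subset _ _) (q^2-1) (by
      intro μ hμ
      obtain ⟨_, T, hTp, hTμ, hfT⟩ := hgood μ hμ
      refine cone_count H A ?_ μ (hf.ne (hfT ▸ hneg)) ?_ hTμ
      · intro a x ha hx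
        simp only [hA, mem_filter, mem_univ, true_and] at *
        rw [hf.smul a x ha, (polar q W).smul_mem_iff ha]
        exact hx
      · simp only [hA, mem_filter, mem_univ, true_and]
        exact ⟨hTp, hfT⟩)
  have h'' : ((q:ℝ)^2-1) * #G0 * (q:ℝ) ^ (2*n) ≤ #A * #G * q := by
    have := (Nat.cast_le (α := ℝ)).2 h
    push_cast [Nat.cast_sub hsq1] at this
    exact this
  have hk : (0:ℝ) < (q:ℝ) ^ (2*n) := by positivity
  have h3 : ((q:ℝ)^2 - 1 - q - (δ/ε) * q) * (q:ℝ) ^ (2*n) ≤ #A * q := by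
    refine le_of_mul_le_mul_right ?_ hGpos
    calc _ = (((q:ℝ)^2 - 1 - q - (δ/ε) * q) * #G) * (q:ℝ) ^ (2*n) := by ring
      _ ≤ (((q:ℝ)^2 - 1) * #G0) * (q:ℝ) ^ (2*n) := mul_le_mul_of_nonneg_right hG0c hk.le
      _ ≤ _ := h''
      _ = _ := by ring
  refine le_of_mul_le_mul_right ?_ hqpos
  calc ((q:ℝ) ^ (2*n+1) - (2 + δ/ε) * (q:ℝ) ^ (2*n)) * q
      = ((q:ℝ)^2 - q - q - (δ/ε) * q) * (q:ℝ) ^ (2*n) := by ring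
    _ ≤ ((q:ℝ)^2 - 1 - q - (δ/ε) * q) * (q:ℝ) ^ (2*n) :=
        mul_le_mul_of_nonneg_right (by linarith) hk.le
    _ ≤ _ := h3

/-- vector version of `v_π - v_(π^σ)` -/
noncomputable def vw (p q : ℕ) {F : Type} [Field F] {m : ℕ} (W : Submodule F (Fin m → F))
    (x : Fin m → F) : ZMod p :=
  if herm q x x = 0 then (if x ∈ W then 1 else 0) - (if x ∈ polar q W then 1 else 0) else 0

theorem vc_sub (H : HH q F) {f : (Fin (2*n+2) → F) → ZMod p}
    (hf : VC p q n f) {W : Submodule F (Fin (2*n+2) → F)} (hW : Module.finrank F W = n + 1)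
    (a : ZMod p) : VC p q n (fun x => f x - a * vw p q W x) where
  zero := by simp [hf.zero, vw]
  iso x hx := by
    by_contra h
    apply hx
    have : f x = 0 := by by_contra h'; exact h (hf.iso x h')
    simp [vw, h, this]
  smul b x hb := by
    simp only [vw]
    rw [hf.smul b x hb, W.smul_mem_iff hb, (polar q W).smul_mem_iff hb, herm_smul_left,
      herm_smul_right]
    simp [hb]
  sum μ hμ := by
    rw [sum_sub_distrib, hf.sum μ hμ, ← mul_sum]
    have h1 : ∑ x with x ∈ μ, vw p q W x = 0 := by
      have e : ∑ x with x ∈ μ, vw p q W x =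
          ∑ x with x ∈ μ, ((if x ∈ W then (1 : ZMod p) else 0) -
            (if x ∈ polar q W then 1 else 0)) := by
        refine sum_congr rfl fun x hx => ?_
        simp only [mem_filter, mem_univ, true_and] at hx
        simp [vw, hμ.2 x hx]
      rw [e, sum_sub_distrib, sum_boole, sum_boole, filter_filter, filter_filter]
      have c1 := cardSub H (W ⊓ μ)
      have c2 := cardSub H (polar q W ⊓ μ)
      rw [finrank_inf_polar H hμ hW, ← c1] at c2
      simp only [Submodule.mem_inf] at c1 c2
      simp only [and_comm (a := _ ∈ μ)]
      rw [c2, sub_self]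
    rw [h1]; ring

theorem reduce_count (H : HH q F)
    {f : (Fin (2*n+2) → F) → ZMod p}
    (hf : VC p q n f) {W : Submodule F (Fin (2*n+2) → F)} {a : ZMod p} {C : ℝ}
    (hW : Module.finrank F W = n + 1) (hW' : Module.finrank F (polar q W) = n + 1)
    (ha0 : a ≠ 0) {R R' : Fin (2*n+2) → F} (hRW : R ∈ W) (hRp : R ∉ polar q W)
    (hR'W : R' ∈ polar q W) (hR'p : R' ∉ W)
    (hA : (q:ℝ)^(2*n+1) - C * (q:ℝ)^(2*n) ≤ #{T | T ∈ W ∧ f T = a})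
    (hA' : (q:ℝ)^(2*n+1) - C * (q:ℝ)^(2*n) ≤ #{T | T ∈ polar q W ∧ f T = - a})
    (hq : 3 * C + 4 ≤ q) (hqpos : (0:ℝ) < q) :
    #{x | f x - a * vw p q W x ≠ 0} < #{x | f x ≠ 0} := by
  have hk : (0:ℝ) < (q:ℝ) ^ (2*n) := by positivity
  have hq0 : 0 < q := by exact_mod_cast hqpos
  have hps : (q:ℝ) ^ (2*n+1) = q * (q:ℝ) ^ (2*n) := by ring
  set A : Finset (Fin (2*n+2) → F) := {T | T ∈ W ∧ f T = a} with hAdef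
  set A' : Finset (Fin (2*n+2) → F) := {T | T ∈ polar q W ∧ f T = - a} with hA'def
  have hti : ¬ TotallyIsotropic q W := fun h => hRp (ti_le_polar H h hRW)
  have hti' : ¬ TotallyIsotropic q (polar q W) := by
    intro h
    have := ti_le_polar H h hR'W
    rw [polar_polar H] at this
    exact hR'p this
  have hi := iso_card_le H hW hti
  have hi' := iso_card_le H hW' hti'
  set Lost : Finset (Fin (2*n+2) → F) := {x | x ∈ W ∧ x ∉ polar q W ∧ f x = a} with hLost
  set g1 : Finset (Fin (2*n+2) → F) := {x | (x ∈ W ∧ herm q x x = 0) ∧ f x = 0} with hg1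
  set g2 : Finset (Fin (2*n+2) → F) := {x | (x ∈ polar q W ∧ herm q x x = 0) ∧ f x = 0} with hg2
  have hg1c : #g1 + #A ≤ #{x | x ∈ W ∧ herm q x x = 0} := by
    rw [← card_union_of_disjoint]
    · apply card_le_card
      intro x hx
      simp only [hg1, hAdef, mem_union, mem_filter, mem_univ, true_and] at *
      rcases hx with hx | hx
      · exact hx.1
      · exact ⟨hx.1, hf.iso x (by rw [hx.2]; exact ha0)⟩
    · rw [disjoint_left]
      intro x hx hx'
      simp only [hg1, hAdef, mem_filter, mem_univ, true_and] at *
      exact ha0 (by rw [← hx'.2, hx.2])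
  have hg2c : #g2 + #A' ≤ #{x | x ∈ polar q W ∧ herm q x x = 0} := by
    rw [← card_union_of_disjoint]
    · apply card_le_card
      intro x hx
      simp only [hg2, hA'def, mem_union, mem_filter, mem_univ, true_and] at *
      rcases hx with hx | hx
      · exact hx.1
      · exact ⟨hx.1, hf.iso x (by rw [hx.2]; exact neg_ne_zero.2 ha0)⟩
    · rw [disjoint_left]
      intro x hx hx'
      simp only [hg2, hA'def, mem_filter, mem_univ, true_and] at *
      exact ha0 (neg_eq_zero.1 (by rw [← hx'.2, hx.2]))
  have hD : #{x | x ∈ W ⊓ polar q W} ≤ q ^ (2*n) := by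
    rw [cardSub H]
    refine Nat.pow_le_pow_right hq0 ?_
    have hlt : W ⊓ polar q W < W := by
      refine lt_of_le_of_ne inf_le_left fun h => hRp ?_
      have := hRW
      rw [← h] at this
      exact this.2
    have := Submodule.finrank_lt_finrank_of_lt hlt
    omega
  have hLc : #A ≤ #Lost + #{x | x ∈ W ⊓ polar q W} := by
    refine le_trans (card_le_card ?_) (card_union_le _ _)
    intro x hx
    simp only [hAdef, hLost, mem_union, mem_filter, mem_univ, true_and, Submodule.mem_inf] at *
    tauto
  have hfin : #{x | f x - a * vw p q W x ≠ 0} + #Lost ≤ #{x | f x ≠ 0} + (#g1 + #g2) := by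
    rw [← card_union_of_disjoint]
    · refine le_trans (card_le_card (t := ({x | f x ≠ 0} : Finset (Fin (2*n+2) → F)) ∪ (g1 ∪ g2)) ?_)
        ((card_union_le _ _).trans (Nat.add_le_add_left (card_union_le _ _) _))
      intro x hx
      simp only [hLost, hg1, hg2, mem_union, mem_filter, mem_univ, true_and] at *
      rcases hx with hx | hx
      · by_cases hfx : f x = 0
        · right
          by_cases hxx : herm q x x = 0
          · by_cases hxW : x ∈ W
            · exact Or.inl ⟨⟨hxW, hxx⟩, hfx⟩
            by_cases hxp : x ∈ polar q W
            · exact Or.inr ⟨⟨hxp, hxx⟩, hfx⟩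
            · exact absurd (by simp [vw, hfx, hxW, hxp]) hx
          · exact absurd (by simp [vw, hfx, hxx]) hx
        · exact Or.inl hfx
      · left; rw [hx.2.2]; exact ha0
    · rw [disjoint_left]
      intro x hx hx'
      simp only [hLost, mem_filter, mem_univ, true_and] at *
      have hxx : herm q x x = 0 := hf.iso x (by rw [hx'.2.2]; exact ha0)
      exact hx (by simp [vw, hx'.1, hx'.2.1, hx'.2.2, hxx])
  -- arithmetic
  have r1 : (#g1 : ℝ) + #A ≤ (q + 1) * (q:ℝ) ^ (2*n) := by exact_mod_cast hg1c.trans hi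
  have r2 : (#g2 : ℝ) + #A' ≤ (q + 1) * (q:ℝ) ^ (2*n) := by exact_mod_cast hg2c.trans hi'
  have r3 : (#A : ℝ) ≤ #Lost + (q:ℝ) ^ (2*n) := by
    exact_mod_cast hLc.trans (Nat.add_le_add_left hD _)
  have r4 : (#{x | f x - a * vw p q W x ≠ 0} : ℝ) + #Lost ≤ #{x | f x ≠ 0} + (#g1 + #g2) := by
    exact_mod_cast hfin
  have r5 : (#{x | f x - a * vw p q W x ≠ 0} : ℝ) < #{x | f x ≠ 0} := by
    rw [hps] at hA hA'
    have : (3 * C + 4) * (q:ℝ) ^ (2*n) ≤ q * (q:ℝ) ^ (2*n) :=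
      mul_le_mul_of_nonneg_right hq hk.le
    linarith
  exact_mod_cast r5

theorem reduce (H : HH q F) (hp : p.Prime) (hpq : (q : ZMod p) = 0)
    {f : (Fin (2*n+2) → F) → ZMod p}
    (hf : VC p q n f) (hne : ∃ x, f x ≠ 0) {δ : ℝ} (hδ : 1 ≤ δ)
    (hS : (#{x | f x ≠ 0} : ℝ) ≤ δ * (q:ℝ) ^ (2*n+1))
    (hq : 3 * (2 + δ / ((1/2) * (1/(4*δ))^(n+1))) + 4 ≤ q) :
    ∃ W : Submodule F (Fin (2*n+2) → F), Module.finrank F W = n + 1 ∧ ∃ a : ZMod p,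
      #{x | f x - a * vw p q W x ≠ 0} < #{x | f x ≠ 0} := by
  set ε : ℝ := (1/2) * (1/(4*δ))^(n+1) with hε
  have hδ0 : 0 < δ := by linarith
  have hε0 : 0 < ε := by positivity
  have hε1 : ε ≤ 1/2 := by
    have : (1/(4*δ))^(n+1) ≤ 1 := by
      apply pow_le_one₀ (by positivity)
      rw [div_le_one (by positivity)]; linarith
    rw [hε]; linarith
  set C : ℝ := 2 + δ / ε with hC
  have hC2 : 2 ≤ C := by have : 0 < δ / ε := by positivity
                         linarith
  have hq4 : 4 ≤ q := by
    have : (4:ℝ) ≤ q := by linarith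
    exact_mod_cast this
  have hqpos : (0:ℝ) < q := by linarith
  obtain ⟨X, hX, hXc⟩ := exists_heavy H hpq hf hne hq4 hδ0 hS (n+1) le_rfl
  set W := polar q X with hWdef
  have hW : Module.finrank F W = n + 1 := by
    have := finrank_polar H X
    rw [← hWdef, hX] at this
    omega
  have hW' : Module.finrank F (polar q W) = n + 1 := by
    have := finrank_polar H W
    omega
  have hk : (0:ℝ) < (q:ℝ) ^ (2*n) := by positivity
  have hps : (q:ℝ) ^ (2*n+1) = q * (q:ℝ) ^ (2*n) := by ring
  obtain ⟨R, hRB, hRp, hA'⟩ := key_step H hpq hf hδ0 hε0 hS hW {x | f x ≠ 0 ∧ x ∈ W}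
    (fun x hx => by simpa using hx) hXc (by linarith)
  simp only [mem_filter, mem_univ, true_and] at hRB
  set a := f R with ha
  set A' : Finset (Fin (2*n+2) → F) := {T | T ∈ polar q W ∧ f T = - a} with hA'def
  obtain ⟨R', hR'B, hR'p, hA⟩ := key_step H hpq hf hδ0 hε0 hS hW' A' (fun x hx => by
      simp only [hA'def, mem_filter, mem_univ, true_and] at hx
      refine ⟨?_, hx.1⟩
      rw [hx.2]; exact neg_ne_zero.2 hRB.1) (by
      refine le_trans ?_ hA'
      rw [hps]
      have h1 : (2 * C) * (q:ℝ) ^ (2*n) ≤ q * (q:ℝ) ^ (2*n) :=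
        mul_le_mul_of_nonneg_right (by linarith) hk.le
      have h2 : ε * (q * (q:ℝ) ^ (2*n)) ≤ (1/2) * (q * (q:ℝ) ^ (2*n)) :=
        mul_le_mul_of_nonneg_right hε1 (by positivity)
      linarith) (by linarith)
  simp only [hA'def, mem_filter, mem_univ, true_and] at hR'B
  rw [hR'B.2, neg_neg, polar_polar H] at hA
  rw [polar_polar H] at hR'p
  exact ⟨W, hW, a, reduce_count H hf hW hW' hRB.1 hRB.2 hRp hR'B.1 hR'p hA hA' hq hqpos⟩

theorem vector_main (H : HH q F) (hp : p.Prime) (hpq : (q : ZMod p) = 0) {δ : ℝ} (hδ : 1 ≤ δ)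
    (hq : 3 * (2 + δ / ((1/2) * (1/(4*δ))^(n+1))) + 4 ≤ q) (N : ℕ) :
    ∀ f : (Fin (2*n+2) → F) → ZMod p, VC p q n f → #{x | f x ≠ 0} ≤ N →
    (#{x | f x ≠ 0} : ℝ) ≤ δ * (q:ℝ) ^ (2*n+1) →
    ∃ (m : ℕ) (π : Fin m → Submodule F (Fin (2*n+2) → F)) (a : Fin m → ZMod p),
      (∀ j, Module.finrank F (π j) = n + 1) ∧ ∀ x, f x = ∑ j, a j * vw p q (π j) x := by
  have triv : ∀ f : (Fin (2*n+2) → F) → ZMod p, (¬ ∃ x, f x ≠ 0) →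
      ∃ (m : ℕ) (π : Fin m → Submodule F (Fin (2*n+2) → F)) (a : Fin m → ZMod p),
      (∀ j, Module.finrank F (π j) = n + 1) ∧ ∀ x, f x = ∑ j, a j * vw p q (π j) x := by
    intro f h
    push Not at h
    exact ⟨0, Fin.elim0, Fin.elim0, fun j => j.elim0, fun x => by simp [h x]⟩
  induction N with
  | zero =>
    intro f hf hN _
    apply triv
    rintro ⟨x, hx⟩
    have : x ∈ ({x | f x ≠ 0} : Finset _) := by simpa using hx
    have := card_pos.2 ⟨x, this⟩
    omega
  | succ N ih =>
    intro f hf hN hS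
    by_cases hne : ∃ x, f x ≠ 0
    · obtain ⟨W, hW, a, hlt⟩ := reduce H hp hpq hf hne hδ hS hq
      obtain ⟨m, π, b, h1, h2⟩ := ih _ (vc_sub H hf hW a) (by omega)
        (le_trans (by exact_mod_cast hlt.le) hS)
      refine ⟨m+1, Fin.cons W π, Fin.cons a b, ?_, ?_⟩
      · intro j
        refine Fin.cases ?_ (fun i => ?_) j
        · exact hW
        · exact h1 i
      · intro x
        rw [Fin.sum_univ_succ]
        simp only [Fin.cons_zero, Fin.cons_succ]
        rw [← h2 x]; ring
    · exact triv f hne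

end reduction

section translation

open Classical

variable {p q : ℕ} {F : Type} [Field F] [Fintype F] {n : ℕ}

theorem span_eq_iff {m : ℕ} {P : Submodule F (Fin m → F)} (hP : Module.finrank F P = 1)
    (x : Fin m → F) : Submodule.span F {x} = P ↔ x ∈ P ∧ x ≠ 0 := by
  constructor
  · rintro rfl
    refine ⟨Submodule.mem_span_singleton_self x, ?_⟩
    rintro rfl
    rw [Submodule.span_zero_singleton, finrank_bot] at hP
    omega
  · rintro ⟨hx, h0⟩
    refine Submodule.eq_of_le_of_finrank_eq ((Submodule.span_singleton_le_iff_mem _ _).2 hx) ?_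
    rw [finrank_span_singleton h0, hP]

theorem card_fiber (H : HH q F) {m : ℕ} {P : Submodule F (Fin m → F)}
    (hP : Module.finrank F P = 1) : #{x | Submodule.span F {x} = P} = q ^ 2 - 1 := by
  have h := cardSub H P
  rw [hP, mul_one] at h
  have e : ({x | Submodule.span F {x} = P} : Finset (Fin m → F)) =
      ({x | x ∈ P} : Finset (Fin m → F)).erase 0 := by
    ext x
    simp only [mem_filter, mem_univ, true_and, mem_erase, span_eq_iff hP]
    tauto
  rw [e, card_erase_of_mem (by simp), h]

theorem point_span {m : ℕ} {P : Submodule F (Fin m → F)} (hP : IsHermPoint q P) :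
    ∃ x, Submodule.span F {x} = P ∧ herm q x x = 0 := by
  obtain ⟨x, hx, h0⟩ := Submodule.exists_mem_ne_zero_of_ne_bot
    (p := P) (by rintro rfl; have := hP.1; simp at this)
  exact ⟨x, (span_eq_iff hP.1 x).2 ⟨hx, h0⟩, hP.2 x hx⟩

theorem vc_of_codeword (H : HH q F) {c : Submodule F (Fin (2*n+2) → F) → ZMod p}
    (hc : IsCodeword p q n c) : VC p q n (fun x => c (Submodule.span F {x})) where
  zero := by
    apply hc.1
    intro h
    have := h.1
    rw [Submodule.span_zero_singleton, finrank_bot] at this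
    omega
  iso x hx := by
    by_contra h
    exact hx (hc.1 _ fun h' => h (h'.2 x (Submodule.mem_span_singleton_self x)))
  smul a x ha := by
    rw [Submodule.span_singleton_smul_eq (IsUnit.mk0 a ha)]
  sum μ hμ := by
    have h := hc.2 μ hμ
    rw [← sum_fiberwise' (g := fun x : Fin (2*n+2) → F => Submodule.span F {x})]
    have h2 : ∀ P : Submodule F (Fin (2*n+2) → F),
        ∑ x ∈ ({x | x ∈ μ} : Finset _) with Submodule.span F {x} = P, c P =
        if IsHermPoint q P ∧ P ≤ μ then (q^2-1) • c P else 0 := by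
      intro P
      rw [sum_const]
      split_ifs with hP
      · congr 1
        rw [← card_fiber H hP.1.1, filter_filter]
        congr 1
        ext x
        simp only [mem_filter, mem_univ, true_and, and_iff_right_iff_imp]
        rintro rfl
        exact hP.2 (Submodule.mem_span_singleton_self x)
      · by_cases hh : IsHermPoint q P
        · have : #{x ∈ ({x | x ∈ μ} : Finset (Fin (2*n+2) → F)) | Submodule.span F {x} = P} = 0 := by
            rw [card_eq_zero, filter_eq_empty_iff]
            rintro x hx rfl
            simp only [mem_filter, mem_univ, true_and] at hx
            exact hP ⟨hh, (Submodule.span_singleton_le_iff_mem _ _).2 hx⟩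
          rw [this, zero_smul]
        · rw [hc.1 P hh, smul_zero]
    rw [sum_congr rfl (fun P _ => h2 P), ← sum_filter, ← smul_sum]
    have h3 : ∑ᶠ P ∈ {P | IsHermPoint q P ∧ P ≤ μ}, c P =
        ∑ P with IsHermPoint q P ∧ P ≤ μ, c P := by
      rw [← finsum_mem_coe_finset]
      simp
    rw [← h3, h, smul_zero]

theorem card_support (H : HH q F) {c : Submodule F (Fin (2*n+2) → F) → ZMod p}
    (hc : IsCodeword p q n c) :
    #{x | c (Submodule.span F {x}) ≠ 0} ≤ q ^ 2 * wt c := by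
  have hw : wt c = #{P | c P ≠ 0} := by
    rw [wt, Nat.card_eq_fintype_card, Fintype.card_subtype]
  rw [hw]
  refine card_le_mul_card_image_of_maps_to (f := fun x => Submodule.span F {x}) ?_ _ ?_
  · intro x hx
    simpa using hx
  · intro P hP
    simp only [mem_filter, mem_univ, true_and] at hP
    have hh : IsHermPoint q P := by
      by_contra h; exact hP (hc.1 P h)
    refine le_trans (card_le_card ?_) ((card_fiber H hh.1).le.trans (Nat.sub_le _ _))
    intro x hx
    simp only [mem_filter, mem_univ, true_and] at *
    exact hx.2

theorem mk_HH (hp : p.Prime) {k : ℕ} (hq : q = p ^ k) (h2 : 2 ≤ q)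
    (hF : Fintype.card F = q ^ 2) : HH q F where
  two := h2
  card := hF
  add x y := by
    obtain ⟨r, hr⟩ := CharP.exists F
    obtain ⟨N, hrp, hN⟩ := FiniteField.card F r
    have : r = p := by
      rw [hF, hq, ← pow_mul] at hN
      have h1 : r ∣ p ^ (k*2) := by rw [hN]; exact dvd_pow_self r N.ne_zero
      exact (Nat.prime_dvd_prime_iff_eq hrp hp).1 (hrp.dvd_of_dvd_pow h1)
    subst this
    have := Fact.mk hp
    rw [hq]
    exact add_pow_char_pow x y r k

theorem vw_eq {m : ℕ} (W : Submodule F (Fin m → F)) {x : Fin m → F}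
    (hP : IsHermPoint q (Submodule.span F {x})) :
    vsub p q W (Submodule.span F {x}) - vsub p q (polar q W) (Submodule.span F {x}) =
      vw p q W x := by
  have h := hP.2 x (Submodule.mem_span_singleton_self x)
  simp [vsub, vw, hP, h]

theorem main_aux (hp : p.Prime) (hn : 1 ≤ n) {δ : ℝ} (hδ : 1 ≤ δ) {hh : ℕ} (hqp : q = p ^ hh)
    (hq : 3 * (2 + δ / ((1/2) * (1/(4*δ))^(n+1))) + 4 ≤ q)
    (hF : Fintype.card F = q ^ 2)
    (c : Submodule F (Fin (2*n+2) → F) → ZMod p)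
    (hc : IsCodeword p q n c) (hwt : (wt c : ℝ) ≤ δ * (q:ℝ)^(2*n-1)) :
    ∃ (m : ℕ) (π : Fin m → Submodule F (Fin (2*n+2) → F)) (a : Fin m → ZMod p),
      (∀ j, Module.finrank F (π j) = n + 1) ∧
      c = fun P => ∑ j, a j * (vsub p q (π j) P - vsub p q (polar q (π j)) P) := by
  have hδ0 : 0 < δ := by linarith
  have hq4 : 4 ≤ q := by
    have : (0:ℝ) < δ / ((1/2) * (1/(4*δ))^(n+1)) := by positivity
    have : (4:ℝ) ≤ q := by linarith
    exact_mod_cast this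
  have H : HH q F := mk_HH hp hqp (by omega) hF
  have hpq : (q : ZMod p) = 0 := by
    rw [ZMod.natCast_eq_zero_iff, hqp]
    refine dvd_pow_self p ?_
    rintro rfl
    simp at hqp; omega
  have hb : (#{x : Fin (2*n+2) → F | c (Submodule.span F {x}) ≠ 0} : ℝ) ≤
      δ * (q:ℝ) ^ (2*n+1) := by
    have h1 : (#{x : Fin (2*n+2) → F | c (Submodule.span F {x}) ≠ 0} : ℝ) ≤ (q:ℝ)^2 * wt c := by
      exact_mod_cast card_support H hc
    refine h1.trans ?_
    calc (q:ℝ)^2 * wt c ≤ (q:ℝ)^2 * (δ * (q:ℝ)^(2*n-1)) :=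
          mul_le_mul_of_nonneg_left hwt (by positivity)
      _ = δ * (q:ℝ) ^ (2*n-1+2) := by ring
      _ = _ := by rw [show 2*n-1+2 = 2*n+1 by omega]
  obtain ⟨m, π, a, h1, h2⟩ := vector_main H hp hpq hδ hq _ _ (vc_of_codeword H hc) le_rfl hb
  refine ⟨m, π, a, h1, ?_⟩
  funext P
  by_cases hP : IsHermPoint q P
  · obtain ⟨x, rfl, _⟩ := point_span hP
    rw [h2 x]
    exact sum_congr rfl fun j _ => by rw [vw_eq (π j) hP]
  · rw [hc.1 P hP]
    simp [vsub, hP]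

end translation

end helpers

/-- For fixed `p`, `δ` and `n` there is a constant `Q̄` such that for all
`q = p^h ≥ Q̄`, every code word of weight at most `δ·q^(2n-1)` is an `F_p`-linear
combination of code words `v_π - v_(π^σ)` with `π` an `n`-space. -/
theorem stmt17 (p n : ℕ) (hp : p.Prime) (hn : 1 ≤ n) (δ : ℝ) (hδ : 0 < δ) :
    ∃ Qbar : ℝ,
      ∀ (hh q : ℕ), q = p ^ hh → Qbar ≤ (q:ℝ) →
      ∀ (F : Type) [Field F] [Fintype F], Fintype.card F = q ^ 2 →
      ∀ c : Submodule F (Fin (2*n+2) → F) → ZMod p,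
        IsCodeword p q n c → (wt c : ℝ) ≤ δ * (q:ℝ)^(2*n-1) →
        ∃ (m : ℕ) (π : Fin m → Submodule F (Fin (2*n+2) → F))
          (a : Fin m → ZMod p),
          (∀ j, Module.finrank F (π j) = n + 1) ∧
          c = fun P => ∑ j, a j *
            (vsub p q (π j) P - vsub p q (polar q (π j)) P) := by
  refine ⟨3 * (2 + (max δ 1) / ((1/2) * (1/(4*(max δ 1)))^(n+1))) + 4, ?_⟩
  intro hh q hqp hq F _ _ hF c hc hwt
  exact main_aux hp hn (le_max_right _ _) hqp hq hF c hc
    (hwt.trans (mul_le_mul_of_nonneg_right (le_max_left _ _) (by positivity)))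

end HermCode
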